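/- Let X and Y be algebraic varieties over the same algebraically closed field k, and let x ∈ X and y ∈ Y be regular closed points. Then the Riemann–Zariski spaces RZ(X,x) and RZ(Y,y) are homeomorphic if and only if X and Y have the same dimension. -/

import Mathlib

open AlgebraicGeometry CategoryTheory

universe u

noncomputable section

/-- The homomorphism `𝒪_{X,x} → K` from the stalk at a point to the function field of an
integral scheme. -/
def stalkToFunctionField (X : Scheme.{u}) [IsIntegral X] (x : X) :
    X.presheaf.stalk x →+* X.functionField :=
  algebraMap (X.presheaf.stalk x) X.functionField

/-- A point of the Riemann–Zariski space attached to a local ring `R` and a field `K`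
(via `φ : R → K`): (the equivalence class of) a valuation of `K`, encoded by its
valuation ring, a valuation subring of `K` which *dominates* `R`, i.e. contains `φ(R)`
and whose maximal ideal pulls back to the maximal ideal of `R`.  (Such a valuation is
automatically trivial on any field contained in `R`.) -/
structure RZPoint {R K : Type u} [CommRing R] [IsLocalRing R] [Field K]
    (φ : R →+* K) where
  val : ValuationSubring K
  dom_le : ∀ a : R, φ a ∈ val
  dom_lt : ∀ a ∈ IsLocalRing.maximalIdeal R,
    (⟨φ a, dom_le a⟩ : val) ∈ IsLocalRing.maximalIdeal val

/-- The Zariski topology on the Riemann–Zariski space: it is generated by the basic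
open sets `E(f₁,…,f_m) = {ν | f₁,…,f_m ∈ R_ν}`, equivalently by the `E(f)`, `f ∈ K`. -/
instance {R K : Type u} [CommRing R] [IsLocalRing R] [Field K] (φ : R →+* K) :
    TopologicalSpace (RZPoint φ) :=
  TopologicalSpace.generateFrom {s | ∃ f : K, s = {v : RZPoint φ | f ∈ v.val}}

/-- The Riemann–Zariski space `RZ(X,x)` of an (integral) algebraic variety `X` at a
point `x`: the space of all valuations of the function field `K` of `X` extending the
trivial valuation of the base field (this is automatic) whose valuation ring dominates
the local ring `𝒪_{X,x}`, with the Zariski topology. -/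
def RZ (X : Scheme.{u}) [IsIntegral X] (x : X) : Type u :=
  RZPoint (stalkToFunctionField X x)

instance (X : Scheme.{u}) [IsIntegral X] (x : X) : TopologicalSpace (RZ X x) :=
  inferInstanceAs (TopologicalSpace (RZPoint (stalkToFunctionField X x)))

/-- A local ring is *regular* if its maximal ideal can be generated by a number of
elements equal to its Krull dimension. -/
def IsRegularLocal (R : Type*) [CommRing R] [IsLocalRing R] : Prop :=
  ∃ s : Finset R, Ideal.span (s : Set R) = IsLocalRing.maximalIdeal R ∧
    (s.card : WithBot ℕ∞) = ringKrullDim R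

section ValuationExtension

open IsLocalRing

theorem ValuationSubring.mem_nonunits_comap {K N : Type*} [Field K] [Field N] (f : K →+* N)
    (U : ValuationSubring N) (x : K) : x ∈ (U.comap f).nonunits ↔ f x ∈ U.nonunits := by
  simp [ValuationSubring.mem_nonunits_iff_or, ValuationSubring.mem_comap, map_inv₀]

theorem ValuationSubring.inv_mem_of_notMem_nonunits {K : Type*} [Field K]
    {V : ValuationSubring K} {x : K} (h : x ∉ V.nonunits) : x⁻¹ ∈ V := by
  by_contra h'
  exact h (V.mem_nonunits_iff_or.mpr (Or.inr h'))

theorem ValuationSubring.mul_mem_nonunits {K : Type*} [Field K] {V : ValuationSubring K}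
    {x y : K} (hx : x ∈ V.nonunits) (hy : y ∈ V) : x * y ∈ V.nonunits := by
  rw [ValuationSubring.mem_nonunits_iff] at *
  rw [map_mul]
  exact (mul_le_of_le_one_right' ((V.valuation_le_one_iff y).mpr hy)).trans_lt hx

theorem ValuationSubring.one_notMem_nonunits {K : Type*} [Field K] (V : ValuationSubring K) :
    (1 : K) ∉ V.nonunits := by
  simp [ValuationSubring.mem_nonunits_iff]

/-- The centre of a valuation ring on a ring mapping to it. -/
def ValuationSubring.center {S N : Type*} [CommRing S] [Field N] (U : ValuationSubring N)
    (f : S →+* N) (h : ∀ s, f s ∈ U) : Ideal S :=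
  (maximalIdeal U).comap (f.codRestrict U.toSubring h)

instance ValuationSubring.center_isPrime {S N : Type*} [CommRing S] [Field N]
    (U : ValuationSubring N) (f : S →+* N) (h : ∀ s, f s ∈ U) : (U.center f h).IsPrime :=
  Ideal.IsPrime.comap _

theorem ValuationSubring.mem_center {S N : Type*} [CommRing S] [Field N] (U : ValuationSubring N)
    (f : S →+* N) (h : ∀ s, f s ∈ U) (s : S) : s ∈ U.center f h ↔ f s ∈ U.nonunits :=
  (ValuationSubring.coe_mem_nonunits_iff (A := U) (a := ⟨f s, h s⟩)).symm

theorem ValuationSubring.exists_comap_eq {K N : Type*} [Field K] [Field N] (f : K →+* N)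
    (V : ValuationSubring K) : ∃ U : ValuationSubring N, U.comap f = V := by
  obtain ⟨U, hU, hloc⟩ := exists_factor_valuationRing (f.comp V.subtype)
  refine ⟨U, le_antisymm (fun x hx => ?_) fun x hx => hU ⟨x, hx⟩⟩
  by_contra hxV
  have hx0 : x ≠ 0 := by rintro rfl; exact hxV V.zero_mem
  have hi : x⁻¹ ∈ V := (V.mem_or_inv_mem x).resolve_left hxV
  have hu : IsUnit ((f.comp V.subtype).codRestrict U.toSubring hU ⟨x⁻¹, hi⟩) := by
    refine IsUnit.of_mul_eq_one (⟨f x, hx⟩ : U.toSubring) (Subtype.ext ?_)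
    change f x⁻¹ * f x = 1
    rw [← map_mul, inv_mul_cancel₀ hx0, map_one]
  obtain ⟨u, hu⟩ := hloc.map_nonunit _ hu
  apply hxV
  have h1 : (u : V) * (↑u⁻¹ : V) = 1 := u.mul_inv
  rw [hu] at h1
  have h2 : x⁻¹ * ((↑u⁻¹ : V) : K) = 1 := congrArg Subtype.val h1
  have : x = ((↑u⁻¹ : V) : K) := by
    rw [← mul_one x, ← h2, ← mul_assoc, mul_inv_cancel₀ hx0, one_mul]
  rw [this]
  exact (↑u⁻¹ : V).2

theorem ValuationSubring.mem_of_isIntegral {S N : Type*} [CommRing S] [Field N] [Algebra S N]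
    (U : ValuationSubring N) (h : ∀ s, algebraMap S N s ∈ U) {z : N} (hz : IsIntegral S z) :
    z ∈ U := by
  obtain ⟨p, hp, hpz⟩ := hz
  let f : S →+* U := (algebraMap S N).codRestrict U.toSubring h
  have : IsIntegral U z := by
    refine ⟨p.map f, hp.map f, ?_⟩
    rw [Polynomial.eval₂_map]
    exact hpz
  obtain ⟨y, hy⟩ := IsIntegrallyClosed.isIntegral_iff.mp this
  exact hy ▸ y.2

theorem ValuationSubring.isIntegral_of_forall_mem {S N : Type*} [CommRing S] [Field N]
    [Algebra S N] (z : N)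
    (h : ∀ U : ValuationSubring N, (∀ s, algebraMap S N s ∈ U) → z ∈ U) : IsIntegral S z := by
  by_contra hz
  have hz' : z ∉ (integralClosure S N).toSubring := hz
  have : IsIntegrallyClosedIn (integralClosure S N).toSubring N :=
    inferInstanceAs (IsIntegrallyClosedIn (integralClosure S N) N)
  obtain ⟨U, hU, hzU⟩ := Subring.exists_le_valuationSubring_of_isIntegrallyClosedIn hz'
  exact hzU (h U fun s => hU (isIntegral_algebraMap (R := S) (A := N) (x := s)))

theorem ValuationSubring.exists_normalized_relation {L N : Type*} [Field L] [Field N]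
    [Algebra L N] (V : ValuationSubring L) {z : N} (hz : IsAlgebraic L z) :
    ∃ (n j : ℕ) (a : ℕ → L), j ≤ n ∧ a j = 1 ∧ (∀ i, a i ∈ V) ∧
      (∀ i, j < i → a i ∈ V.nonunits) ∧
      ∑ i ∈ Finset.range (n + 1), algebraMap L N (a i) * z ^ i = 0 := by
  obtain ⟨p, hp, hpz⟩ := hz
  obtain ⟨m, hm, hmax⟩ := p.support.exists_max_image (fun i => V.valuation (p.coeff i))
    (Polynomial.support_nonempty.mpr hp)
  let T := p.support.filter fun i => V.valuation (p.coeff i) = V.valuation (p.coeff m)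
  have hT : T.Nonempty := ⟨m, by simp [T, Polynomial.mem_support_iff.mp hm]⟩
  obtain ⟨hj1, hj2⟩ := Finset.mem_filter.mp (T.max'_mem hT)
  set j := T.max' hT with hj
  have hc : p.coeff j ≠ 0 := Polynomial.mem_support_iff.mp hj1
  have hv : V.valuation (p.coeff j) ≠ 0 := by simpa using hc
  refine ⟨p.natDegree, j, fun i => p.coeff i / p.coeff j, Polynomial.le_natDegree_of_ne_zero hc,
    div_self hc, fun i => ?_, fun i hi => ?_, ?_⟩
  · rw [← V.valuation_le_one_iff, map_div₀]
    refine div_le_one_of_le₀ ?_ zero_le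
    by_cases h0 : p.coeff i = 0
    · simp [h0]
    · rw [hj2]
      exact hmax i (Polynomial.mem_support_iff.mpr h0)
  · rw [ValuationSubring.mem_nonunits_iff, map_div₀, div_lt_one₀ (zero_lt_iff.mpr hv)]
    by_cases h0 : p.coeff i = 0
    · simpa [h0] using zero_lt_iff.mpr hv
    · rw [hj2]
      refine lt_of_le_of_ne (hmax i (Polynomial.mem_support_iff.mpr h0)) fun h => ?_
      have : i ∈ T := Finset.mem_filter.mpr ⟨Polynomial.mem_support_iff.mpr h0, h⟩
      exact absurd (T.le_max' i this) (not_le.mpr hi)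
  · rw [Polynomial.aeval_eq_sum_range] at hpz
    have : ∑ i ∈ Finset.range (p.natDegree + 1),
        algebraMap L N (p.coeff i / p.coeff j) * z ^ i =
        (algebraMap L N (p.coeff j))⁻¹ *
          ∑ i ∈ Finset.range (p.natDegree + 1), p.coeff i • z ^ i := by
      rw [Finset.mul_sum]
      refine Finset.sum_congr rfl fun i _ => ?_
      rw [map_div₀, Algebra.smul_def, div_eq_inv_mul, mul_assoc]
    rw [this, hpz, mul_zero]

theorem ValuationSubring.le_of_forall_isIntegral {L N : Type*} [Field L] [Field N] [Algebra L N]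
    [Algebra.IsAlgebraic L N] (V : ValuationSubring L) (U₁ U₂ : ValuationSubring N)
    (h₁ : U₁.comap (algebraMap L N) = V) (h₂ : U₂.comap (algebraMap L N) = V)
    (h : ∀ z : N, IsIntegral V z → z ∈ U₂.nonunits → z ∈ U₁.nonunits) : U₁ ≤ U₂ := by
  intro z hz
  by_cases hz0 : z = 0
  · rw [hz0]; exact U₂.zero_mem
  obtain ⟨n, j, a, hjn, haj, ha, haj', hsum⟩ :=
    V.exists_normalized_relation (Algebra.IsAlgebraic.isAlgebraic (R := L) z)
  let b : N := ∑ i ∈ Finset.range (n + 1 - j), algebraMap L N (a (j + i)) * z ^ i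
  let e : N := ∑ i ∈ Finset.range j, algebraMap L N (a i) * z⁻¹ ^ (j - 1 - i)
  have hbe : b * z = -e := by
    have h1 : (b * z + e) * z ^ j = 0 := by
      have hn : n + 1 = j + (n + 1 - j) := by omega
      rw [hn, Finset.sum_range_add] at hsum
      have he : e * z ^ j = z * ∑ i ∈ Finset.range j, algebraMap L N (a i) * z ^ i := by
        rw [Finset.sum_mul, Finset.mul_sum]
        refine Finset.sum_congr rfl fun i hi => ?_
        have hi := Finset.mem_range.mp hi
        obtain ⟨l, rfl⟩ : ∃ l, j = i + 1 + l := ⟨j - (i + 1), by omega⟩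
        have : i + 1 + l - 1 - i = l := by omega
        rw [this, pow_add, inv_pow]
        field_simp
        ring
      have hb : b * z * z ^ j = z * ∑ i ∈ Finset.range (n + 1 - j),
          algebraMap L N (a (j + i)) * z ^ (j + i) := by
        rw [mul_assoc, Finset.sum_mul, Finset.mul_sum]
        refine Finset.sum_congr rfl fun i _ => ?_
        ring
      rw [add_mul, he, hb, ← mul_add, add_comm, hsum, mul_zero]
    exact eq_neg_of_add_eq_zero_left ((mul_eq_zero.mp h1).resolve_right (pow_ne_zero _ hz0))
  have hbmem : ∀ U : ValuationSubring N, (∀ s, algebraMap V N s ∈ U) → z ∈ U → b ∈ U :=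
    fun U hU hzU => U.toSubring.sum_mem fun i _ =>
      U.mul_mem _ _ (hU ⟨_, ha _⟩) (U.toSubring.pow_mem hzU _)
  have hemem : ∀ U : ValuationSubring N, (∀ s, algebraMap V N s ∈ U) → z⁻¹ ∈ U → e ∈ U :=
    fun U hU hzU => U.toSubring.sum_mem fun i _ =>
      U.mul_mem _ _ (hU ⟨_, ha _⟩) (U.toSubring.pow_mem hzU _)
  have hVU : ∀ U : ValuationSubring N, U.comap (algebraMap L N) = V →
      ∀ s, algebraMap V N s ∈ U := by
    rintro U rfl s
    exact s.2
  have hb : IsIntegral V b := by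
    refine ValuationSubring.isIntegral_of_forall_mem b fun U hU => ?_
    rcases U.mem_or_inv_mem z with hzU | hzU
    · exact hbmem U hU hzU
    · have : b = -(e * z⁻¹) := by rw [← neg_mul, ← hbe, mul_assoc, mul_inv_cancel₀ hz0, mul_one]
      rw [this]
      exact U.neg_mem _ (U.mul_mem _ _ (hemem U hU hzU) hzU)
  have he : IsIntegral V e := by
    refine ValuationSubring.isIntegral_of_forall_mem e fun U hU => ?_
    rcases U.mem_or_inv_mem z with hzU | hzU
    · rw [← neg_neg e, ← hbe]
      exact U.neg_mem _ (U.mul_mem _ _ (hbmem U hU hzU) hzU)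
    · exact hemem U hU hzU
  have hbn : b ∉ U₁.nonunits := by
    intro hb1
    apply U₁.one_notMem_nonunits
    have hn : n + 1 - j = (n - j) + 1 := by omega
    have hb' : b = ∑ i ∈ Finset.range (n - j), algebraMap L N (a (j + (i + 1))) * z ^ (i + 1)
        + 1 := by
      simp only [b]
      rw [hn, Finset.sum_range_succ']
      simp [haj]
    have h1 : (1 : N) = b - ∑ i ∈ Finset.range (n - j),
        algebraMap L N (a (j + (i + 1))) * z ^ (i + 1) := by rw [hb']; ring
    rw [h1]
    refine sub_mem hb1 (sum_mem fun i _ => U₁.mul_mem_nonunits ?_ (U₁.toSubring.pow_mem hz _))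
    rw [← ValuationSubring.mem_nonunits_comap, h₁]
    exact haj' _ (by omega)
  have hbi : b⁻¹ ∈ U₂ := ValuationSubring.inv_mem_of_notMem_nonunits fun hb2 => hbn (h b hb hb2)
  have hb0 : b ≠ 0 := by
    intro h0
    exact hbn (by rw [h0]; exact U₁.nonunits.zero_mem)
  have : z = -e * b⁻¹ := by rw [← hbe]; field_simp
  rw [this]
  exact U₂.mul_mem _ _ (U₂.neg_mem _ (U₂.mem_of_isIntegral (hVU _ h₂) he)) hbi

theorem IsIntegralClosure.exists_algEquiv_mem_iff (A L : Type*) {N S : Type*} [CommRing A]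
    [IsDomain A] [IsIntegrallyClosed A] [Field L] [Field N] [CommRing S] [Algebra A L]
    [IsFractionRing A L] [Algebra L N] [Algebra A N] [IsScalarTower A L N] [Algebra A S]
    [Algebra S N] [IsScalarTower A S N] [IsIntegralClosure S A N] [FiniteDimensional L N]
    [IsGalois L N] (P Q : Ideal S) [P.IsPrime] [Q.IsPrime] (h : P.under A = Q.under A) :
    ∃ (σ : N ≃ₐ[L] N) (g : S ≃ₐ[A] S), (∀ s, algebraMap S N (g s) = σ (algebraMap S N s)) ∧
      ∀ s, g s ∈ Q ↔ s ∈ P := by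
  have : IsDomain S := (IsIntegralClosure.algebraMap_injective S A N).isDomain _
  have : IsFractionRing S N := IsIntegralClosure.isFractionRing_of_finite_extension A L N S
  have : Algebra.IsInvariant A S (S ≃ₐ[A] S) := Algebra.isInvariant_of_isGalois' A L N S
  have : Finite (S ≃ₐ[A] S) := Finite.of_equiv _ (galRestrict A L N S).toEquiv
  obtain ⟨g, rfl⟩ := Algebra.IsInvariant.exists_smul_of_under_eq A S (S ≃ₐ[A] S) P Q h
  refine ⟨(galRestrict A L N S).symm g, g, fun s => ?_, fun s => ?_⟩
  · rw [galRestrict_symm_algebraMap_apply]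
  · exact Ideal.smul_mem_pointwise_smul_iff

/-- The valuation rings of a finite Galois extension over a given valuation ring of the base
field are conjugate. -/
theorem ValuationSubring.exists_eq_comap_of_comap_eq {L N : Type*} [Field L] [Field N]
    [Algebra L N] [FiniteDimensional L N] [IsGalois L N] (V : ValuationSubring L)
    (U₁ U₂ : ValuationSubring N) (h₁ : U₁.comap (algebraMap L N) = V)
    (h₂ : U₂.comap (algebraMap L N) = V) : ∃ σ : N ≃ₐ[L] N, U₁ = U₂.comap (σ : N →+* N) := by
  let S := integralClosure V N
  have hVU : ∀ U : ValuationSubring N, U.comap (algebraMap L N) = V →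
      ∀ s, algebraMap V N s ∈ U := by
    rintro U rfl s
    exact s.2
  have hS : ∀ U : ValuationSubring N, U.comap (algebraMap L N) = V →
      ∀ s : S, algebraMap S N s ∈ U :=
    fun U hU s => U.mem_of_isIntegral (hVU U hU) s.2
  have hun : ∀ (U : ValuationSubring N) (hU : U.comap (algebraMap L N) = V),
      (U.center (algebraMap S N) (hS U hU)).under V = maximalIdeal V := by
    intro U hU
    have key : ∀ t : L, t ∈ V.nonunits ↔ algebraMap L N t ∈ U.nonunits := fun t => by
      rw [← ValuationSubring.mem_nonunits_comap, hU]
    ext s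
    rw [Ideal.mem_comap, U.mem_center, ← IsScalarTower.algebraMap_apply,
      ← ValuationSubring.coe_mem_nonunits_iff, key]
    rfl
  obtain ⟨σ, g, hg, hgP⟩ := IsIntegralClosure.exists_algEquiv_mem_iff V L (N := N)
    (U₁.center (algebraMap S N) (hS U₁ h₁)) (U₂.center (algebraMap S N) (hS U₂ h₂))
    ((hun U₁ h₁).trans (hun U₂ h₂).symm)
  have hσ : (U₂.comap (σ : N →+* N)).comap (algebraMap L N) = V := by
    rw [← h₂, ValuationSubring.comap_comap]
    congr 1
    ext t
    exact σ.commutes t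
  have hz : ∀ z : N, IsIntegral V z →
      (z ∈ U₁.nonunits ↔ z ∈ (U₂.comap (σ : N →+* N)).nonunits) := by
    intro z hz
    have h := hgP ⟨z, hz⟩
    rw [ValuationSubring.mem_center, ValuationSubring.mem_center, hg] at h
    rw [ValuationSubring.mem_nonunits_comap]
    exact h.symm
  exact ⟨σ, le_antisymm
    (V.le_of_forall_isIntegral _ _ h₁ hσ fun z h => (hz z h).mpr)
    (V.le_of_forall_isIntegral _ _ hσ h₁ fun z h => (hz z h).mp)⟩

end ValuationExtension

section EtaleChart

open IsLocalRing

/-- The local ring `R` is generated by the maximal ideal `m` of `A` in the way the local ring of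
an étale neighbourhood is: its maximal ideal is `mR`, its residue field is that of `A`, and it is
a localization of a ring which is integral over `A`. -/
structure IsEtaleChart {A : Type*} [CommRing A] (m : Ideal A) (R : Type*) [CommRing R]
    [IsLocalRing R] [Algebra A R] : Prop where
  map_eq : m.map (algebraMap A R) = maximalIdeal R
  exists_sub_mem : ∀ r : R, ∃ a : A, r - algebraMap A R a ∈ maximalIdeal R
  exists_isIntegral : ∀ r : R, ∃ s : R, IsUnit s ∧ IsIntegral A s ∧ IsIntegral A (s * r)

theorem IsEtaleChart.ringHom_ext {A R C : Type*} [CommRing A] [CommRing R] [IsLocalRing R]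
    [Algebra A R] [CommRing C] [IsLocalRing C] [IsNoetherianRing C] {m : Ideal A}
    (hR : IsEtaleChart m R) {f g : R →+* C}
    (h : ∀ a, f (algebraMap A R a) = g (algebraMap A R a))
    (hm : ∀ a ∈ m, g (algebraMap A R a) ∈ maximalIdeal C) : f = g := by
  have key : ∀ n r, f r - g r ∈ maximalIdeal C ^ n := by
    intro n
    induction n with
    | zero => simp
    | succ n ih =>
      have aux : ∀ t ∈ m.map (algebraMap A R),
          f t - g t ∈ maximalIdeal C ^ (n + 1) ∧ g t ∈ maximalIdeal C := by
        intro t ht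
        refine Submodule.span_induction ?_ ?_ ?_ ?_ ht
        · rintro _ ⟨a, ha, rfl⟩
          rw [h, sub_self]
          exact ⟨zero_mem _, hm a ha⟩
        · simp
        · rintro x y - - ⟨hx, hx'⟩ ⟨hy, hy'⟩
          rw [map_add, map_add, add_sub_add_comm]
          exact ⟨add_mem hx hy, add_mem hx' hy'⟩
        · rintro r x - ⟨hx, hx'⟩
          have : f (r • x) - g (r • x) = f r * (f x - g x) + (f r - g r) * g x := by
            simp only [smul_eq_mul, map_mul]; ring
          rw [this, smul_eq_mul, map_mul]
          refine ⟨add_mem (Ideal.mul_mem_left _ _ hx) ?_, Ideal.mul_mem_left _ _ hx'⟩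
          rw [pow_succ]
          exact Ideal.mul_mem_mul (ih r) hx'
      intro r
      obtain ⟨a, ha⟩ := hR.exists_sub_mem r
      rw [← hR.map_eq] at ha
      have := (aux _ ha).1
      rwa [map_sub, map_sub, h, sub_sub_sub_cancel_right] at this
  ext r
  rw [← sub_eq_zero, ← Ideal.mem_bot,
    ← Ideal.iInf_pow_eq_bot_of_isLocalRing (maximalIdeal C) (maximalIdeal.isMaximal C).ne_top]
  exact Ideal.mem_iInf.mpr fun n => key n r

theorem exists_finiteDimensional_isGalois (L : Type*) (K : Type u) [Field L] [Field K]
    [Algebra L K] [FiniteDimensional L K] [Algebra.IsSeparable L K] :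
    ∃ (N : Type u) (_ : Field N) (_ : Algebra L N) (_ : Algebra K N) (_ : IsScalarTower L K N),
      FiniteDimensional L N ∧ IsGalois L N := by
  have : Algebra.IsSeparable L (SeparableClosure K) := Algebra.IsSeparable.trans L K _
  have : IsSepClosure L (SeparableClosure K) := ⟨inferInstance, inferInstance⟩
  have : IsGalois L (SeparableClosure K) := inferInstance
  exact ⟨IntermediateField.normalClosure L K (SeparableClosure K), inferInstance, inferInstance,
    inferInstance, inferInstance, inferInstance, inferInstance⟩

/-- The limit of a family of valuation rings along an ultrafilter. -/
def ValuationSubring.ultralimit {ι K : Type*} [Field K] (l : Ultrafilter ι)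
    (W : ι → ValuationSubring K) : ValuationSubring K where
  carrier := {x | ∀ᶠ i in l, x ∈ W i}
  mul_mem' hx hy := by filter_upwards [hx, hy] with i h₁ h₂ using (W i).mul_mem _ _ h₁ h₂
  one_mem' := .of_forall fun i => (W i).one_mem
  add_mem' hx hy := by filter_upwards [hx, hy] with i h₁ h₂ using (W i).add_mem _ _ h₁ h₂
  zero_mem' := .of_forall fun i => (W i).zero_mem
  neg_mem' hx := by filter_upwards [hx] with i h₁ using (W i).neg_mem _ h₁
  mem_or_inv_mem' x := by
    change (∀ᶠ i in l, x ∈ W i) ∨ (∀ᶠ i in l, x⁻¹ ∈ W i)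
    rw [← Ultrafilter.eventually_or]
    exact .of_forall fun i => (W i).mem_or_inv_mem x

theorem ValuationSubring.mem_ultralimit {ι K : Type*} [Field K] {l : Ultrafilter ι}
    {W : ι → ValuationSubring K} {x : K} : x ∈ ultralimit l W ↔ ∀ᶠ i in l, x ∈ W i := Iff.rfl

theorem ValuationSubring.mem_nonunits_ultralimit {ι K : Type*} [Field K] {l : Ultrafilter ι}
    {W : ι → ValuationSubring K} {x : K} (h : ∀ i, x ∈ (W i).nonunits) :
    x ∈ (ultralimit l W).nonunits := by
  rw [ValuationSubring.mem_nonunits_iff_or]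
  by_cases hx : x = 0
  · exact Or.inl hx
  · refine Or.inr fun h' => ?_
    obtain ⟨i, hi⟩ := (mem_ultralimit.mp h').exists
    exact (((W i).mem_nonunits_iff_or.mp (h i)).resolve_left hx) hi

/-- The compositum of a valuation ring of `K` with a valuation ring of a subfield containing its
restriction. -/
theorem ValuationSubring.exists_le_comap_eq {L K : Type*} [Field L] [Field K] [Algebra L K]
    (W : ValuationSubring K) (V : ValuationSubring L) (h : W.comap (algebraMap L K) ≤ V) :
    ∃ W' : ValuationSubring K, W ≤ W' ∧ W'.comap (algebraMap L K) = V := by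
  let T : Subring K :=
    { carrier := {x | ∃ s : L, algebraMap L K s ∈ W ∧ s⁻¹ ∈ V ∧ s ≠ 0 ∧ algebraMap L K s * x ∈ W}
      mul_mem' := by
        rintro x y ⟨s, hs, hs', h0, hx⟩ ⟨t, ht, ht', h0', hy⟩
        refine ⟨s * t, ?_, ?_, mul_ne_zero h0 h0', ?_⟩
        · rw [map_mul]; exact W.mul_mem _ _ hs ht
        · rw [mul_inv]; exact V.mul_mem _ _ hs' ht'
        · rw [map_mul, mul_mul_mul_comm]; exact W.mul_mem _ _ hx hy
      one_mem' := ⟨1, by simp [W.one_mem], by simp [V.one_mem], one_ne_zero, by simp [W.one_mem]⟩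
      add_mem' := by
        rintro x y ⟨s, hs, hs', h0, hx⟩ ⟨t, ht, ht', h0', hy⟩
        refine ⟨s * t, ?_, ?_, mul_ne_zero h0 h0', ?_⟩
        · rw [map_mul]; exact W.mul_mem _ _ hs ht
        · rw [mul_inv]; exact V.mul_mem _ _ hs' ht'
        · have : algebraMap L K (s * t) * (x + y) =
              algebraMap L K t * (algebraMap L K s * x) +
                algebraMap L K s * (algebraMap L K t * y) := by
            rw [map_mul]; ring
          rw [this]
          exact W.add_mem _ _ (W.mul_mem _ _ ht hx) (W.mul_mem _ _ hs hy)
      zero_mem' := ⟨1, by simp [W.one_mem], by simp [V.one_mem], one_ne_zero, by simp [W.zero_mem]⟩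
      neg_mem' := by
        rintro x ⟨s, hs, hs', h0, hx⟩
        exact ⟨s, hs, hs', h0, by rw [mul_neg]; exact W.neg_mem _ hx⟩ }
  have hWT : W.toSubring ≤ T := fun x hx =>
    ⟨1, by simp [W.one_mem], by simp [V.one_mem], one_ne_zero, by simpa using hx⟩
  refine ⟨⟨T, fun x => (W.mem_or_inv_mem x).imp (@hWT x) (@hWT x⁻¹)⟩, hWT, ?_⟩
  refine le_antisymm ?_ fun x hx => ?_
  · rintro x ⟨s, hs, hs', h0, hx⟩
    rw [← map_mul] at hx
    have := V.mul_mem _ _ hs' (h hx)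
    rwa [inv_mul_cancel_left₀ h0] at this
  · change ∃ s : L, _
    rcases (W.comap (algebraMap L K)).mem_or_inv_mem x with hxW | hxW
    · exact ⟨1, by simp [W.one_mem], by simp [V.one_mem], one_ne_zero, by simpa using hxW⟩
    · by_cases hx0 : x = 0
      · exact ⟨1, by simp [W.one_mem], by simp [V.one_mem], one_ne_zero, by simp [hx0, W.zero_mem]⟩
      · refine ⟨x⁻¹, hxW, by rwa [inv_inv], inv_ne_zero hx0, ?_⟩
        rw [← map_mul, inv_mul_cancel₀ hx0, map_one]
        exact W.one_mem

/-- The valuation rings of `K` which contain the image of a ring and have a centre containing a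
given ideal. -/
structure Centered {A K : Type*} [CommRing A] [Field K] (φ : A →+* K) (I : Ideal A) where
  /-- the valuation ring -/
  val : ValuationSubring K
  map_mem : ∀ a, φ a ∈ val
  map_mem_nonunits : ∀ a ∈ I, φ a ∈ val.nonunits

instance {A K : Type*} [CommRing A] [Field K] (φ : A →+* K) (I : Ideal A) :
    TopologicalSpace (Centered φ I) :=
  TopologicalSpace.generateFrom {s | ∃ f : K, s = {v : Centered φ I | f ∈ v.val}}

theorem Centered.ext {A K : Type*} [CommRing A] [Field K] {φ : A →+* K} {I : Ideal A}
    {v w : Centered φ I} (h : v.val = w.val) : v = w := by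
  cases v; cases w; cases h; rfl

theorem RZPoint.ext {R K : Type u} [CommRing R] [IsLocalRing R] [Field K] {φ : R →+* K}
    {v w : RZPoint φ} (h : v.val = w.val) : v = w := by
  cases v; cases w; cases h; rfl

theorem IsEtaleChart.mem_nonunits {A K R : Type*} [CommRing A] [Field K] [CommRing R]
    [IsLocalRing R] [Algebra A R] [Algebra A K] [Algebra R K] [IsScalarTower A R K] {m : Ideal A}
    (hR : IsEtaleChart m R) {W : ValuationSubring K}
    (h : ∀ r, algebraMap R K r ∈ W) (hm : ∀ a ∈ m, algebraMap A K a ∈ W.nonunits) :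
    ∀ r ∈ maximalIdeal R, algebraMap R K r ∈ W.nonunits := by
  have : m.map (algebraMap A R) ≤ W.center (algebraMap R K) h := by
    rw [Ideal.map_le_iff_le_comap]
    intro a ha
    rw [Ideal.mem_comap, W.mem_center, ← IsScalarTower.algebraMap_apply]
    exact hm a ha
  rw [hR.map_eq] at this
  exact fun r hr => (W.mem_center _ h r).mp (this hr)

theorem IsEtaleChart.exists_comap_eq {A L K R : Type u} [CommRing A] [IsDomain A]
    [IsIntegrallyClosed A] [Field L] [Algebra A L] [IsFractionRing A L] [Field K] [Algebra L K]
    [FiniteDimensional L K] [Algebra.IsSeparable L K] [CommRing R] [IsLocalRing R] [Algebra A R]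
    [Algebra A K] [Algebra R K] [IsScalarTower A R K] [IsScalarTower A L K] {m : Ideal A}
    (hR : IsEtaleChart m R) (hmax : m.IsMaximal)
    {V : ValuationSubring L}
    (hV : ∀ a, algebraMap A L a ∈ V) (hVm : ∀ a ∈ m, algebraMap A L a ∈ V.nonunits) :
    ∃ W : ValuationSubring K, W.comap (algebraMap L K) = V ∧ ∀ r, algebraMap R K r ∈ W := by
  obtain ⟨N, _, _, _, _, _, _⟩ := exists_finiteDimensional_isGalois L K
  obtain ⟨U, rfl⟩ := ValuationSubring.exists_comap_eq (algebraMap L N) V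
  obtain ⟨W₀, hW₀, hloc⟩ := exists_factor_valuationRing (algebraMap R K)
  obtain ⟨U₀, rfl⟩ := ValuationSubring.exists_comap_eq (algebraMap K N) W₀
  let _ : Algebra A N := ((algebraMap L N).comp (algebraMap A L)).toAlgebra
  have : IsScalarTower A L N := .of_algebraMap_eq' rfl
  have : IsScalarTower A K N := .of_algebraMap_eq fun a => by
    rw [IsScalarTower.algebraMap_apply A L K, ← IsScalarTower.algebraMap_apply L K N]
    rfl
  let f : R →+* N := (algebraMap K N).comp (algebraMap R K)
  have hfA : ∀ a, f (algebraMap A R a) = algebraMap A N a := fun a => by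
    simp only [f, RingHom.comp_apply]
    rw [← IsScalarTower.algebraMap_apply A R K, ← IsScalarTower.algebraMap_apply A K N]
  let fA : R →ₐ[A] N := { f with commutes' := hfA }
  let S := integralClosure A N
  have hS : ∀ U : ValuationSubring N, (∀ a, algebraMap A N a ∈ U) →
      ∀ s : S, algebraMap S N s ∈ U := fun U hU s => U.mem_of_isIntegral hU s.2
  have hUA : ∀ a, algebraMap A N a ∈ U := hV
  have hU₀A : ∀ a, algebraMap A N a ∈ U₀ := fun a => by rw [← hfA]; exact hW₀ _
  have hnon : ∀ r ∈ maximalIdeal R, f r ∈ U₀.nonunits := by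
    intro r hr
    refine (ValuationSubring.mem_nonunits_comap (algebraMap K N) U₀ _).mp ?_
    refine ValuationSubring.coe_mem_nonunits_iff (a := ⟨algebraMap R K r, hW₀ r⟩) |>.mpr ?_
    exact fun h => hr (hloc.map_nonunit _ h)
  have hunder : ∀ (U : ValuationSubring N) (hU : ∀ a, algebraMap A N a ∈ U)
      (_ : ∀ a ∈ m, algebraMap A N a ∈ U.nonunits),
      (U.center (algebraMap S N) (hS U hU)).under A = m := by
    intro U hU hm
    refine (hmax.eq_of_le (Ideal.IsPrime.ne_top inferInstance) fun a ha => ?_).symm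
    rw [Ideal.mem_comap, U.mem_center, ← IsScalarTower.algebraMap_apply]
    exact hm a ha
  obtain ⟨σ, g, hg, hgP⟩ := IsIntegralClosure.exists_algEquiv_mem_iff A L (N := N)
    (U₀.center (algebraMap S N) (hS U₀ hU₀A)) (U.center (algebraMap S N) (hS U hUA))
    ((hunder U₀ hU₀A fun a ha => by
        rw [← hfA]
        exact hnon _ (hR.map_eq ▸ Ideal.mem_map_of_mem _ ha)).trans
      (hunder U hUA fun a ha => by
        have := hVm a ha
        rwa [ValuationSubring.mem_nonunits_comap] at this).symm)
  refine ⟨(U.comap (σ : N →+* N)).comap (algebraMap K N), ?_, fun r => ?_⟩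
  · rw [ValuationSubring.comap_comap, ValuationSubring.comap_comap]
    congr 1
    ext z
    change σ (algebraMap K N (algebraMap L K z)) = algebraMap L N z
    rw [← IsScalarTower.algebraMap_apply L K N, σ.commutes]
  · change σ (f r) ∈ U
    obtain ⟨s, hs, hsi, hsr⟩ := hR.exists_isIntegral r
    have hsP : f s ∉ U₀.nonunits := by
      intro h
      obtain ⟨u, hu⟩ := hs.exists_right_inv
      apply U₀.one_notMem_nonunits
      have h1 : (1 : N) = f s * f u := by rw [← map_mul, hu, map_one]
      rw [h1]
      exact U₀.mul_mem_nonunits h (hW₀ u)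
    have h1 := hgP ⟨f s, hsi.map fA⟩
    rw [ValuationSubring.mem_center, ValuationSubring.mem_center, hg] at h1
    have h2 : σ (f s) ∉ U.nonunits := fun h => hsP (h1.mp h)
    have h3 := ValuationSubring.inv_mem_of_notMem_nonunits h2
    have h4 : σ (f (s * r)) ∈ U := U.mem_of_isIntegral hUA
      ((hsr.map fA).map ((σ : N →ₐ[L] N).restrictScalars A))
    have h5 : σ (f s) ≠ 0 := by
      intro h
      exact h2 (by rw [h]; exact U.nonunits.zero_mem)
    have : σ (f r) = σ (f (s * r)) * (σ (f s))⁻¹ := by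
      rw [map_mul, map_mul]
      field_simp
    rw [this]
    exact U.mul_mem _ _ h4 h3

section EtaleChartField

variable {A L K R : Type u} [CommRing A] [IsDomain A] [IsIntegrallyClosed A] [IsNoetherianRing A]
  [Field L] [Algebra A L] [IsFractionRing A L] [Field K] [Algebra L K] [FiniteDimensional L K]
  [Algebra.IsSeparable L K] [CommRing R] [IsLocalRing R] [Algebra A R] [Algebra A K]
  [Algebra R K] [IsScalarTower A R K] [IsScalarTower A L K] [IsFractionRing R K] {m : Ideal A}

theorem IsEtaleChart.valuationSubring_eq (hR : IsEtaleChart m R) {W₁ W₂ : ValuationSubring K}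
    (h₁ : ∀ r, algebraMap R K r ∈ W₁) (h₂ : ∀ r, algebraMap R K r ∈ W₂)
    (hm : ∀ a ∈ m, algebraMap A K a ∈ W₂.nonunits)
    (h : W₁.comap (algebraMap L K) = W₂.comap (algebraMap L K)) : W₁ = W₂ := by
  obtain ⟨N, _, _, _, _, _, _⟩ := exists_finiteDimensional_isGalois L K
  obtain ⟨U₁, rfl⟩ := ValuationSubring.exists_comap_eq (algebraMap K N) W₁
  obtain ⟨U₂, rfl⟩ := ValuationSubring.exists_comap_eq (algebraMap K N) W₂
  rw [ValuationSubring.comap_comap, ValuationSubring.comap_comap,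
    ← IsScalarTower.algebraMap_eq] at h
  obtain ⟨σ, rfl⟩ := ValuationSubring.exists_eq_comap_of_comap_eq _ U₁ U₂ h rfl
  let _ : Algebra A N := ((algebraMap L N).comp (algebraMap A L)).toAlgebra
  have : IsScalarTower A L N := .of_algebraMap_eq' rfl
  have : IsScalarTower A K N := .of_algebraMap_eq fun a => by
    rw [IsScalarTower.algebraMap_apply A L K, ← IsScalarTower.algebraMap_apply L K N]
    rfl
  let f : R →+* N := (algebraMap K N).comp (algebraMap R K)
  have hfA : ∀ a, f (algebraMap A R a) = algebraMap A N a := fun a => by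
    simp only [f, RingHom.comp_apply]
    rw [← IsScalarTower.algebraMap_apply A R K, ← IsScalarTower.algebraMap_apply A K N]
  let fA : R →ₐ[A] N := { f with commutes' := hfA }
  obtain ⟨T, hTA, _⟩ : ∃ T : Subring N, (∀ z, z ∈ T ↔ IsIntegral A z) ∧ IsNoetherianRing T :=
    ⟨(integralClosure A N).toSubring, fun _ => Iff.rfl,
      IsIntegralClosure.isNoetherianRing A L N (integralClosure A N)⟩
  have hT : ∀ t : T, (t : N) ∈ U₂ := fun t =>
    U₂.mem_of_isIntegral (S := A) (fun a => by
      rw [← hfA]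
      exact h₂ _) ((hTA _).mp t.2)
  obtain ⟨P, _, hP⟩ : ∃ P : Ideal T, P.IsPrime ∧ ∀ t, t ∈ P ↔ (t : N) ∈ U₂.nonunits :=
    ⟨U₂.center T.subtype hT, U₂.center_isPrime T.subtype hT, U₂.mem_center T.subtype hT⟩
  let C := LocalSubring.ofPrime T P
  have : IsNoetherianRing C.toSubring :=
    IsLocalization.isNoetherianRing P.primeCompl _ inferInstance
  have hC : ∀ g : R →ₐ[A] N, (∀ r, g r ∈ U₂) → ∀ r, g r ∈ C.toSubring := by
    intro g hg r
    obtain ⟨s, hs, hsi, hsr⟩ := hR.exists_isIntegral r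
    have hsP : (⟨g s, (hTA _).mpr (hsi.map g)⟩ : T) ∉ P := by
      intro h
      have h := (hP _).mp h
      obtain ⟨u, hu⟩ := hs.exists_right_inv
      apply U₂.one_notMem_nonunits
      have h1 : (1 : N) = g s * g u := by rw [← map_mul, hu, map_one]
      rw [h1]
      exact U₂.mul_mem_nonunits h (hg u)
    have hu : IsUnit (algebraMap T C.toSubring ⟨g s, (hTA _).mpr (hsi.map g)⟩) :=
      IsLocalization.map_units (M := P.primeCompl) C.toSubring ⟨_, hsP⟩
    obtain ⟨v, hv⟩ := hu.exists_right_inv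
    have hv : g s * v = 1 := congrArg Subtype.val hv
    have : g r = g (s * r) * v := by
      rw [map_mul, mul_right_comm, hv, one_mul]
    rw [this]
    exact C.toSubring.mul_mem (LocalSubring.le_ofPrime T P ((hTA _).mpr (hsr.map g))) v.2
  let g : R →ₐ[A] N := ((σ : N →ₐ[L] N).restrictScalars A).comp fA
  have hfg : (fA : R →+* N).codRestrict C.toSubring (hC fA h₂) =
      (g : R →+* N).codRestrict C.toSubring (hC g h₁) := by
    refine hR.ringHom_ext (fun a => Subtype.ext ?_) fun a ha => ?_
    · exact (fA.commutes a).trans (g.commutes a).symm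
    · have h0 : (⟨algebraMap A N a, (hTA _).mpr isIntegral_algebraMap⟩ : T) ∈ P := by
        rw [hP]
        change algebraMap A N a ∈ _
        rw [IsScalarTower.algebraMap_apply A K N, ← ValuationSubring.mem_nonunits_comap]
        exact hm a ha
      have := (IsLocalization.AtPrime.to_map_mem_maximal_iff C.toSubring P _).mpr h0
      convert! this
      exact Subtype.ext (g.commutes a)
  have hσ : ∀ z : K, σ (algebraMap K N z) = algebraMap K N z := by
    have hr : ∀ r, σ (algebraMap K N (algebraMap R K r)) = algebraMap K N (algebraMap R K r) :=
      fun r => (congrArg Subtype.val (RingHom.congr_fun hfg r)).symm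
    intro z
    obtain ⟨r, s, -, rfl⟩ := IsFractionRing.div_surjective R z
    rw [map_div₀, map_div₀, hr, hr]
  rw [ValuationSubring.comap_comap]
  congr 1
  ext z
  exact hσ z

theorem IsEtaleChart.exists_finset (hR : IsEtaleChart m R)
    (W : ValuationSubring K)
    (hW : ∀ r, algebraMap R K r ∈ W) {f : K} (hf : f ∈ W) :
    ∃ F : Finset L, (∀ x ∈ F, x ∈ W.comap (algebraMap L K)) ∧ ∀ W' : ValuationSubring K,
      (∀ r, algebraMap R K r ∈ W') → (∀ a ∈ m, algebraMap A K a ∈ W'.nonunits) →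
      (∀ x ∈ F, x ∈ W'.comap (algebraMap L K)) → f ∈ W' := by
  classical
  by_contra! hcon
  have hcon' : ∀ F : Finset (W.comap (algebraMap L K)), ∃ W' : ValuationSubring K,
      (∀ r, algebraMap R K r ∈ W') ∧ (∀ a ∈ m, algebraMap A K a ∈ W'.nonunits) ∧
      (∀ x ∈ F, (x : L) ∈ W'.comap (algebraMap L K)) ∧ f ∉ W' := fun F => by
    obtain ⟨W', h₁, h₂, h₃, h₄⟩ := hcon (F.image (↑)) fun x hx => by
      obtain ⟨y, -, rfl⟩ := Finset.mem_image.mp hx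
      exact y.2
    exact ⟨W', h₁, h₂, fun x hx => h₃ _ (Finset.mem_image_of_mem _ hx), h₄⟩
  choose w h₁ h₂ h₃ h₄ using hcon'
  let l : Ultrafilter (Finset (W.comap (algebraMap L K))) := Ultrafilter.of Filter.atTop
  let W₁ := ValuationSubring.ultralimit l w
  have hle : W.comap (algebraMap L K) ≤ W₁.comap (algebraMap L K) := fun x hx => by
    refine Ultrafilter.of_le _ ?_
    filter_upwards [Filter.eventually_ge_atTop {⟨x, hx⟩}] with F hF
    exact h₃ F _ (hF (Finset.mem_singleton_self _))
  obtain ⟨W₂, hW₂, hcomap⟩ := W.exists_le_comap_eq _ hle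
  have heq : W₂ = W₁ := hR.valuationSubring_eq (L := L) (fun r => hW₂ (hW r))
    (fun r => .of_forall fun F => h₁ F r)
    (fun a ha => ValuationSubring.mem_nonunits_ultralimit fun F => h₂ F a ha) hcomap
  have : f ∈ W₁ := heq ▸ hW₂ hf
  obtain ⟨F, hF⟩ := (ValuationSubring.mem_ultralimit.mp this).exists
  exact h₄ F hF

/-- Restriction of valuations to the fraction field of the base of an étale chart is a
homeomorphism. -/
theorem IsEtaleChart.nonempty_homeomorph (hR : IsEtaleChart m R) (hmax : m.IsMaximal) :
    Nonempty (RZPoint (algebraMap R K) ≃ₜ Centered (algebraMap A L) m) := by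
  have hloc : ∀ a ∈ m, algebraMap A R a ∈ maximalIdeal R := fun a ha =>
    hR.map_eq ▸ Ideal.mem_map_of_mem _ ha
  have hm : ∀ (w : RZPoint (algebraMap R K)), ∀ a ∈ m, algebraMap A K a ∈ w.val.nonunits :=
    fun w a ha => by
      rw [IsScalarTower.algebraMap_apply A R K]
      exact ValuationSubring.coe_mem_nonunits_iff.mpr (w.dom_lt _ (hloc a ha))
  let F : RZPoint (algebraMap R K) → Centered (algebraMap A L) m := fun w =>
    { val := w.val.comap (algebraMap L K)
      map_mem := fun a => by
        rw [ValuationSubring.mem_comap, ← IsScalarTower.algebraMap_apply,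
          IsScalarTower.algebraMap_apply A R K]
        exact w.dom_le _
      map_mem_nonunits := fun a ha => by
        rw [ValuationSubring.mem_nonunits_comap, ← IsScalarTower.algebraMap_apply]
        exact hm w a ha }
  have hF : Function.Bijective F := by
    refine ⟨fun w₁ w₂ h => RZPoint.ext ?_, fun v => ?_⟩
    · exact hR.valuationSubring_eq w₁.dom_le w₂.dom_le (hm w₂) (congrArg Centered.val h)
    · obtain ⟨W, hW, hWR⟩ := hR.exists_comap_eq (K := K) hmax v.map_mem v.map_mem_nonunits
      have hWm : ∀ a ∈ m, algebraMap A K a ∈ W.nonunits := fun a ha => by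
        have := v.map_mem_nonunits a ha
        rwa [← hW, ValuationSubring.mem_nonunits_comap, ← IsScalarTower.algebraMap_apply] at this
      exact ⟨⟨W, hWR, fun r hr => ValuationSubring.coe_mem_nonunits_iff.mp
        (hR.mem_nonunits hWR hWm r hr)⟩, Centered.ext hW⟩
  let e := Equiv.ofBijective F hF
  refine ⟨⟨e, ?_, ?_⟩⟩
  · refine continuous_generateFrom_iff.mpr ?_
    rintro _ ⟨f, rfl⟩
    exact TopologicalSpace.isOpen_generateFrom_of_mem ⟨algebraMap L K f, rfl⟩
  · refine continuous_generateFrom_iff.mpr ?_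
    rintro _ ⟨f, rfl⟩
    refine isOpen_iff_forall_mem_open.mpr fun v hv => ?_
    obtain ⟨w, rfl⟩ := e.surjective v
    have hv : f ∈ w.val := by simpa using hv
    obtain ⟨S, hS₁, hS₂⟩ := hR.exists_finset (L := L) w.val w.dom_le hv
    refine ⟨⋂ x ∈ S, {v | x ∈ v.val}, fun v' hv' => ?_, isOpen_biInter_finset fun x _ =>
      TopologicalSpace.isOpen_generateFrom_of_mem ⟨x, rfl⟩, Set.mem_iInter₂.mpr hS₁⟩
    obtain ⟨w', rfl⟩ := e.surjective v'
    have : f ∈ w'.val := hS₂ w'.val w'.dom_le (hm w') (Set.mem_iInter₂.mp hv')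
    simpa using this

end EtaleChartField

end EtaleChart

section Trdeg

open IsLocalRing

theorem exists_algebraicIndependent_of_strictMono (k : Type*) [Field k] (n : ℕ) :
    ∀ {C : Type u} [CommRing C] [IsDomain C] [Algebra k C] (p : Fin (n + 1) → Ideal C)
      (_ : StrictMono p) (_ : ∀ i, (p i).IsPrime),
      ∃ (ι : Type) (_ : Fintype ι) (x : ι → C), Fintype.card ι = n ∧ AlgebraicIndependent k x := by
  induction n with
  | zero =>
    intro C _ _ _ p _ _
    exact ⟨Empty, inferInstance, Empty.elim, rfl,
      algebraicIndependent_empty_type_iff.mpr (algebraMap k C).injective⟩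
  | succ n ih =>
    intro C _ _ _ p hp hprime
    have hle : ∀ i : Fin (n + 1), p 1 ≤ p i.succ := fun i =>
      hp.monotone (Fin.le_def.mpr (by simp))
    have hcm : ∀ i : Fin (n + 1),
        ((p i.succ).map (Ideal.Quotient.mk (p 1))).comap (Ideal.Quotient.mk (p 1)) = p i.succ :=
      fun i => by
        rw [Ideal.comap_map_of_surjective' _ Ideal.Quotient.mk_surjective, Ideal.mk_ker,
          sup_eq_left]
        exact hle i
    obtain ⟨ι, _, z, hcard, hz⟩ := ih (C := C ⧸ p 1)
      (fun i => (p i.succ).map (Ideal.Quotient.mk (p 1)))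
      (fun i j hij => by
        refine lt_of_le_of_ne (Ideal.map_mono (hp (Fin.succ_lt_succ_iff.mpr hij)).le) fun h => ?_
        have := congrArg (Ideal.comap (Ideal.Quotient.mk (p 1))) h
        rw [hcm, hcm] at this
        exact (hp (Fin.succ_lt_succ_iff.mpr hij)).ne this)
      (fun i => Ideal.map_isPrime_of_surjective Ideal.Quotient.mk_surjective
        (by rw [Ideal.mk_ker]; exact hle i))
    choose x hx using fun i => Ideal.Quotient.mk_surjective (I := p 1) (z i)
    obtain rfl : (Ideal.Quotient.mkₐ k (p 1)) ∘ x = z := funext hx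
    have hxi : AlgebraicIndependent k x := hz.of_comp _
    obtain ⟨y, hy, hy0⟩ : ∃ y ∈ p 1, y ≠ 0 := by
      obtain ⟨y, hy, hy'⟩ := SetLike.exists_of_lt (hp (show (0 : Fin (n + 2)) < 1 by simp))
      exact ⟨y, hy, fun h => hy' (h ▸ zero_mem _)⟩
    refine ⟨Option ι, inferInstance, fun o => o.elim y x, by simp [hcard], ?_⟩
    refine (hxi.option_iff_transcendental y).mpr ?_
    rintro ⟨F, hF, hFy⟩
    obtain ⟨G, hG, hG0⟩ := Polynomial.exists_eq_pow_rootMultiplicity_mul_and_not_dvd F hF 0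
    have hGy : Polynomial.aeval y G = 0 := by
      rw [hG] at hFy
      simpa [hy0] using hFy
    apply hG0
    rw [map_zero, sub_zero, Polynomial.X_dvd_iff]
    have h1 : ((G.coeff 0 : Algebra.adjoin k (Set.range x)) : C) ∈ p 1 := by
      rw [← G.divX_mul_X_add, map_add, map_mul, Polynomial.aeval_X, Polynomial.aeval_C] at hGy
      have : algebraMap (Algebra.adjoin k (Set.range x)) C (G.coeff 0) =
          -(Polynomial.aeval y G.divX * y) := (neg_eq_of_add_eq_zero_right hGy).symm
      change algebraMap (Algebra.adjoin k (Set.range x)) C (G.coeff 0) ∈ p 1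
      rw [this]
      exact neg_mem (Ideal.mul_mem_left _ _ hy)
    have hc : ((G.coeff 0 : Algebra.adjoin k (Set.range x)) : C) ∈
        (MvPolynomial.aeval (R := k) x).range := by
      rw [← Algebra.adjoin_range_eq_range_aeval]
      exact (G.coeff 0).2
    obtain ⟨f, hf⟩ := hc
    have h2 : MvPolynomial.aeval (Ideal.Quotient.mkₐ k (p 1) ∘ x) f = 0 := by
      have := MvPolynomial.comp_aeval_apply x (Ideal.Quotient.mkₐ k (p 1)) f
      rw [Function.comp_def, ← this]
      exact Ideal.Quotient.eq_zero_iff_mem.mpr (hf ▸ h1)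
    have h3 : f = 0 := (injective_iff_map_eq_zero _).mp
      (algebraicIndependent_iff_injective_aeval.mp hz) f h2
    rw [h3] at hf
    exact Subtype.ext (by rw [← hf]; simp)

/-- The length of a chain of primes in a domain containing a field is bounded by the
transcendence degree of any field containing the domain. -/
theorem natCast_le_trdeg_of_strictMono {k : Type u} [Field k] {C K : Type u} [CommRing C]
    [IsDomain C] [Algebra k C] [Field K] [Algebra k K] (f : C →ₐ[k] K)
    (hf : Function.Injective f) {n : ℕ} (p : Fin (n + 1) → Ideal C) (hp : StrictMono p)
    (hprime : ∀ i, (p i).IsPrime) : (n : Cardinal.{u}) ≤ Algebra.trdeg k K := by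
  obtain ⟨ι, _, x, hcard, hx⟩ := exists_algebraicIndependent_of_strictMono k n p hp hprime
  simpa [hcard] using (hx.map' hf).lift_cardinalMk_le_trdeg

theorem ringKrullDim_le_of_trdeg_eq {k : Type u} [Field k] {C K : Type u} [CommRing C]
    [IsDomain C] [Algebra k C] [Field K] [Algebra k K] (f : C →ₐ[k] K)
    (hf : Function.Injective f) {d : ℕ} (hd : Algebra.trdeg k K = d) :
    ringKrullDim C ≤ d := by
  refine iSup_le fun c => ?_
  have := natCast_le_trdeg_of_strictMono f hf (fun i => (c i).asIdeal)
    (fun i j hij => c.strictMono hij) (fun i => (c i).isPrime)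
  rw [hd] at this
  exact_mod_cast this

end Trdeg

section SpecializationChain

open IsLocalRing

/-- `X` contains a chain of `n` points, each of which is a proper specialization of the
previous ones. -/
def HasSpecializationChain (X : Type*) [TopologicalSpace X] (n : ℕ) : Prop :=
  ∃ c : Fin n → X, ∀ i j, i < j → c i ⤳ c j ∧ ¬ c j ⤳ c i

theorem HasSpecializationChain.of_homeomorph {X Y : Type*} [TopologicalSpace X]
    [TopologicalSpace Y] (e : X ≃ₜ Y) {n : ℕ} (h : HasSpecializationChain X n) :
    HasSpecializationChain Y n := by
  obtain ⟨c, hc⟩ := h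
  refine ⟨e ∘ c, fun i j hij => ⟨(hc i j hij).1.map e.continuous, fun h' => (hc i j hij).2 ?_⟩⟩
  simpa using h'.map e.symm.continuous

theorem Centered.specializes_iff {A K : Type*} [CommRing A] [Field K] {φ : A →+* K} {I : Ideal A}
    {v w : Centered φ I} : v ⤳ w ↔ w.val ≤ v.val := by
  rw [specializes_iff_forall_open]
  refine ⟨fun h x hx => h {u | x ∈ u.val} (TopologicalSpace.isOpen_generateFrom_of_mem ⟨x, rfl⟩) hx,
    fun h s hs => ?_⟩
  induction hs with
  | basic s hs => obtain ⟨f, rfl⟩ := hs; exact fun hw => h hw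
  | univ => exact fun _ => trivial
  | inter s t _ _ h₁ h₂ => exact fun hw => ⟨h₁ hw.1, h₂ hw.2⟩
  | sUnion S _ ih => rintro ⟨s, hs, hw⟩; exact ⟨s, hs, ih s hs hw⟩

theorem ValuationSubring.nonunits_subset_of_le {K : Type*} [Field K] {V W : ValuationSubring K}
    (h : V ≤ W) {x : K} (hx : x ∈ W.nonunits) : x ∈ V.nonunits := by
  rw [ValuationSubring.mem_nonunits_iff_or] at *
  exact hx.imp_right fun h' h'' => h' (h h'')

/-- A valuation ring of a field containing `k` has at most `trdeg` many specializations. -/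
theorem Centered.natCast_le_trdeg {k A K : Type u} [Field k] [CommRing A] [Algebra k A] [Field K]
    [Algebra k K] {φ : A →ₐ[k] K} {I : Ideal A} (hI : ∃ a ∈ I, φ a ≠ 0) {n : ℕ}
    (h : HasSpecializationChain (Centered (φ : A →+* K) I) n) :
    (n : Cardinal.{u}) ≤ Algebra.trdeg k K := by
  cases n with
  | zero => simp
  | succ n =>
    obtain ⟨c, hc⟩ := h
    let V := (c (Fin.last n)).val
    have hle : ∀ i, V ≤ (c i).val := fun i => by
      rcases (Fin.le_last i).eq_or_lt with rfl | hi
      · exact le_rfl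
      · exact Centered.specializes_iff.mp (hc _ _ hi).1
    have hk : ∀ a, algebraMap k K a ∈ V := fun a => by
      rw [← φ.commutes]; exact (c _).map_mem _
    let _ : Algebra k V := ((algebraMap k K).codRestrict V.toSubring hk).toAlgebra
    let f : V →ₐ[k] K := { V.subtype with commutes' := fun _ => rfl }
    refine natCast_le_trdeg_of_strictMono f Subtype.val_injective
      (Fin.cases ⊥ fun i => (c i).val.center V.subtype fun s => hle i s.2) ?_ ?_
    · refine Fin.strictMono_iff_lt_succ.mpr (Fin.cases ?_ fun i => ?_)
      · obtain ⟨a, ha, ha0⟩ := hI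
        refine lt_of_le_of_ne bot_le fun h => ha0 ?_
        have h1 : (⟨φ a, (c _).map_mem a⟩ : V) ∈
            (c 0).val.center V.subtype fun s => hle 0 s.2 :=
          (ValuationSubring.mem_center _ _ _ _).mpr ((c 0).map_mem_nonunits a ha)
        rw [← show ⊥ = (c 0).val.center V.subtype fun s => hle 0 s.2 from h] at h1
        exact congrArg Subtype.val h1
      · obtain ⟨h₁, h₂⟩ := hc _ _ i.castSucc_lt_succ
        rw [Centered.specializes_iff] at h₁ h₂
        change (c i.castSucc).val.center V.subtype _ < (c i.succ).val.center V.subtype _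
        refine SetLike.lt_iff_le_and_exists.mpr ⟨fun x hx => ?_, ?_⟩
        · rw [ValuationSubring.mem_center] at *
          exact ValuationSubring.nonunits_subset_of_le h₁ hx
        · obtain ⟨z, hz, hz'⟩ := SetLike.not_le_iff_exists.mp h₂
          have hzi := (V.mem_or_inv_mem z).resolve_left fun h => hz' (hle _ h)
          refine ⟨⟨z⁻¹, hzi⟩, ?_, ?_⟩
          · rw [ValuationSubring.mem_center, ValuationSubring.mem_nonunits_iff_or]
            exact Or.inr (by simpa using hz')
          · rw [ValuationSubring.mem_center, ValuationSubring.mem_nonunits_iff_or]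
            rintro (h0 | h0)
            · exact hz' (by rw [inv_eq_zero.mp h0]; exact zero_mem _)
            · exact h0 (by simpa using hz)
    · exact Fin.cases Ideal.isPrime_bot fun i => ValuationSubring.center_isPrime _ _ _

/-- A valuation ring can be refined so that its centre specializes as prescribed. -/
theorem ValuationSubring.exists_le_center_eq {B F : Type u} [CommRing B] [Field F] (f : B →+* F)
    (W : ValuationSubring F) (h : ∀ b, f b ∈ W) (Q : Ideal B) [hQ : Q.IsPrime]
    (hW : W.center f h ≤ Q) : ∃ (V : ValuationSubring F) (h' : ∀ b, f b ∈ V), V ≤ W ∧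
      V.center f h' = Q := by
  let g : B →+* ResidueField W := (residue W).comp (f.codRestrict W.toSubring h)
  have hg : ∀ s : Q.primeCompl, IsUnit (g s) := fun s => by
    rw [isUnit_iff_ne_zero]
    intro h0
    exact s.2 (hW ((residue_eq_zero_iff _).mp h0))
  obtain ⟨T, hT, hloc⟩ := exists_factor_valuationRing
    (IsLocalization.lift (S := Localization.AtPrime Q) (M := Q.primeCompl) hg)
  have hT' : ∀ b, g b ∈ T := fun b => by
    rw [← IsLocalization.lift_eq (S := Localization.AtPrime Q) hg]; exact hT _
  have hTQ : ∀ b, g b ∈ T.nonunits ↔ b ∈ Q := fun b => by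
    have h1 : IsUnit (algebraMap B (Localization.AtPrime Q) b) ↔ b ∈ Q.primeCompl :=
      IsLocalization.AtPrime.isUnit_to_map_iff (Localization.AtPrime Q) Q b
    have h2 := isUnit_map_iff (RingHom.codRestrict _ T.toSubring hT)
      (algebraMap B (Localization.AtPrime Q) b)
    have h3 := ValuationSubring.coe_mem_nonunits_iff (A := T) (a := ⟨g b, hT' b⟩)
    rw [mem_maximalIdeal, mem_nonunits_iff] at h3
    have h4 : RingHom.codRestrict _ T.toSubring hT (algebraMap B (Localization.AtPrime Q) b) =
        (⟨g b, hT' b⟩ : T) := Subtype.ext (IsLocalization.lift_eq hg b)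
    rw [h4] at h2
    exact h3.trans ((not_congr (h2.trans h1)).trans not_not)
  have hinv : ∀ x : W, residue W x ≠ 0 → ∃ h : (x : F)⁻¹ ∈ W,
      residue W ⟨(x : F)⁻¹, h⟩ = (residue W x)⁻¹ := fun x hx => by
    have hx' : (x : F) ∉ W.nonunits := fun h0 =>
      hx ((residue_eq_zero_iff _).mpr (ValuationSubring.coe_mem_nonunits_iff.mp h0))
    have hx0 : (x : F) ≠ 0 := fun h0 => hx' (h0 ▸ W.nonunits.zero_mem)
    refine ⟨ValuationSubring.inv_mem_of_notMem_nonunits hx', ?_⟩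
    refine eq_inv_of_mul_eq_one_left ?_
    rw [← map_mul, ← map_one (residue W)]
    exact congrArg _ (Subtype.ext (inv_mul_cancel₀ hx0))
  let V : ValuationSubring F :=
    { (T.toSubring.comap (residue W)).map W.subtype with
      mem_or_inv_mem' := fun x => by
        rcases W.mem_or_inv_mem x with hx | hx
        · by_cases hT : residue W ⟨x, hx⟩ ∈ T
          · exact Or.inl ⟨⟨x, hx⟩, hT, rfl⟩
          · obtain ⟨h, h'⟩ := hinv ⟨x, hx⟩ fun h0 => hT (h0 ▸ T.zero_mem)
            refine Or.inr ⟨⟨x⁻¹, h⟩, ?_, rfl⟩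
            change residue W _ ∈ T
            rw [h']
            exact (T.mem_or_inv_mem _).resolve_left hT
        · by_cases hT : residue W ⟨x⁻¹, hx⟩ ∈ T
          · exact Or.inr ⟨⟨x⁻¹, hx⟩, hT, rfl⟩
          · obtain ⟨h, h'⟩ := hinv ⟨x⁻¹, hx⟩ fun h0 => hT (h0 ▸ T.zero_mem)
            refine Or.inl ⟨⟨x⁻¹⁻¹, h⟩, ?_, inv_inv x⟩
            change residue W _ ∈ T
            rw [h']
            exact (T.mem_or_inv_mem _).resolve_left hT }
  have hV : ∀ x : W, (x : F) ∈ V ↔ residue W x ∈ T := fun x => by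
    refine ⟨?_, fun hx => ⟨x, hx, rfl⟩⟩
    rintro ⟨y, hy, hyx⟩
    obtain rfl : y = x := Subtype.ext hyx
    exact hy
  have hVW : V ≤ W := by
    rintro _ ⟨x, -, rfl⟩
    exact x.2
  have hVn : ∀ x : W, (x : F) ∈ V.nonunits ↔ residue W x ∈ T.nonunits := fun x => by
    by_cases hx : residue W x = 0
    · refine iff_of_true (ValuationSubring.nonunits_subset_of_le hVW ?_)
        (hx ▸ T.nonunits.zero_mem)
      exact ValuationSubring.coe_mem_nonunits_iff.mpr ((residue_eq_zero_iff _).mp hx)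
    · obtain ⟨h, h'⟩ := hinv x hx
      have hx0 : (x : F) ≠ 0 := fun h0 => hx (by
        rw [show x = 0 from Subtype.ext h0, map_zero])
      rw [ValuationSubring.mem_nonunits_iff_or, ValuationSubring.mem_nonunits_iff_or,
        or_iff_right hx0, or_iff_right hx, ← h', ← hV]
  refine ⟨V, fun b => (hV ⟨f b, h b⟩).mpr (hT' b), hVW, ?_⟩
  ext b
  rw [ValuationSubring.mem_center, ← hTQ]
  exact hVn ⟨f b, h b⟩

theorem ValuationSubring.exists_antitone_center_eq {B F : Type u} [CommRing B] [Field F]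
    (f : B →+* F) (hf : Function.Injective f) (P : ℕ → Ideal B) (hP : Monotone P) (h0 : P 0 = ⊥)
    (hprime : ∀ i, (P i).IsPrime) : ∃ W : ℕ → ValuationSubring F, Antitone W ∧
      ∀ i, ∃ h : ∀ b, f b ∈ W i, (W i).center f h = P i := by
  have step : ∀ i (W : {W : ValuationSubring F // ∃ h : ∀ b, f b ∈ W, W.center f h = P i}),
      ∃ V : {V : ValuationSubring F // ∃ h : ∀ b, f b ∈ V, V.center f h = P (i + 1)},
        V.1 ≤ W.1 := fun i W => by
    obtain ⟨W, h, hW⟩ := W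
    obtain ⟨V, h', hV, hVP⟩ := W.exists_le_center_eq f h (P (i + 1)) (hW ▸ hP i.le_succ)
    exact ⟨⟨V, h', hVP⟩, hV⟩
  choose g hg using step
  let W₀ : {W : ValuationSubring F // ∃ h : ∀ b, f b ∈ W, W.center f h = P 0} :=
    ⟨⊤, fun _ => ValuationSubring.mem_top _, by
      rw [h0, eq_bot_iff]
      intro b hb
      rw [ValuationSubring.mem_center, ValuationSubring.mem_nonunits_iff_or] at hb
      exact (map_eq_zero_iff f hf).mp (hb.resolve_right fun h => h (ValuationSubring.mem_top _))⟩
  let W : ∀ i, {W : ValuationSubring F // ∃ h : ∀ b, f b ∈ W, W.center f h = P i} :=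
    fun i => Nat.rec W₀ g i
  exact ⟨fun i => (W i).1, antitone_nat_of_succ_le fun i => hg i (W i), fun i => (W i).2⟩

open MvPolynomial in
theorem hasSpecializationChain_centered_mvPolynomial (k : Type u) [Field k] (n : ℕ) :
    HasSpecializationChain (Centered
      (algebraMap (MvPolynomial (Fin (n + 1)) k) (FractionRing (MvPolynomial (Fin (n + 1)) k)))
      (RingHom.ker constantCoeff)) (n + 1) := by
  let A := MvPolynomial (Fin (n + 1)) k
  let L := FractionRing A
  let t : L := algebraMap A L (X 0)
  have ht : t ≠ 0 := by
    rw [Ne, FaithfulSMul.algebraMap_eq_zero_iff]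
    exact X_ne_zero 0
  let φ : A →ₐ[k] A := aeval fun i => if i = 0 then X 0 else X 0 * X i
  let ψ : A →ₐ[k] L := aeval fun i => if i = 0 then t else algebraMap A L (X i) / t
  have hφX : ∀ i, φ (X i) = if i = 0 then X 0 else X 0 * X i := aeval_X _
  have hψX : ∀ i, ψ (X i) = if i = 0 then t else algebraMap A L (X i) / t := aeval_X _
  have hφ0 : φ (X 0) = X 0 := by simp [hφX]
  have hψφ : ∀ a, ψ (φ a) = algebraMap A L a := fun a => by
    have : ψ.comp φ = IsScalarTower.toAlgHom k A L := by
      refine MvPolynomial.algHom_ext fun i => ?_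
      by_cases hi : i = 0
      · rw [AlgHom.comp_apply, hφX, if_pos hi, hψX, if_pos rfl, hi]
        rfl
      · rw [AlgHom.comp_apply, hφX, if_neg hi, map_mul, hψX, hψX, if_pos rfl, if_neg hi,
          mul_div_cancel₀ _ ht]
        rfl
    exact DFunLike.congr_fun this a
  have hφ : ∀ b : A, ∃ N a, X 0 ^ N * b = φ a := fun b => by
    induction b using MvPolynomial.induction_on with
    | C c => exact ⟨0, C c, by rw [pow_zero, one_mul]; exact (φ.commutes c).symm⟩
    | add p q hp hq =>
      obtain ⟨N, a, h⟩ := hp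
      obtain ⟨M, b, h'⟩ := hq
      refine ⟨N + M, X 0 ^ M * a + X 0 ^ N * b, ?_⟩
      rw [map_add, map_mul, map_mul, map_pow, map_pow, hφ0, ← h, ← h']
      ring
    | mul_X p i hp =>
      obtain ⟨N, a, h⟩ := hp
      refine ⟨N + 1, a * if i = 0 then X 0 * X 0 else X i, ?_⟩
      rw [map_mul, ← h]
      by_cases hi : i = 0
      · rw [if_pos hi, map_mul, hφ0, hi]; ring
      · rw [if_neg hi, hφX, if_neg hi]; ring
  have hψ : Function.Injective ψ := by
    refine (injective_iff_map_eq_zero _).mpr fun b hb => ?_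
    obtain ⟨N, a, h⟩ := hφ b
    have ha : algebraMap A L a = 0 := by rw [← hψφ, ← h, map_mul, hb, mul_zero]
    rw [FaithfulSMul.algebraMap_eq_zero_iff] at ha
    rw [ha, map_zero] at h
    exact (mul_eq_zero.mp h).resolve_left (pow_ne_zero _ (X_ne_zero 0))
  let π : ℕ → A →ₐ[k] A := fun i => aeval fun j => if j.val < i then 0 else X j
  have hπX : ∀ i l, π i (X l) = if l.val < i then 0 else X l := fun i l => aeval_X _ l
  have hπ : ∀ i j, i ≤ j → (π j).comp (π i) = π j := fun i j hij =>
    MvPolynomial.algHom_ext fun l => by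
      by_cases hl : l.val < i
      · rw [AlgHom.comp_apply, hπX, if_pos hl, map_zero, hπX, if_pos (hl.trans_le hij)]
      · rw [AlgHom.comp_apply, hπX, if_neg hl]
  obtain ⟨W, hW, hWP⟩ := ValuationSubring.exists_antitone_center_eq (ψ : A →+* L) hψ
    (fun i => RingHom.ker (π i)) (fun i j hij b hb => by
      rw [RingHom.mem_ker] at *
      rw [← hπ i j hij, AlgHom.comp_apply, hb, map_zero])
    (by
      have : π 0 = AlgHom.id k A := MvPolynomial.algHom_ext fun l => by
        rw [hπX, if_neg (Nat.not_lt_zero _)]; rfl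
      rw [this]
      exact (RingHom.injective_iff_ker_eq_bot (RingHom.id A)).mp Function.injective_id)
    (fun i => RingHom.ker_isPrime _)
  have hmem : ∀ i b, ψ b ∈ (W i).nonunits ↔ π i b = 0 := fun i b => by
    obtain ⟨h, h'⟩ := hWP i
    rw [← RingHom.mem_ker, ← h', ValuationSubring.mem_center]
    rfl
  refine ⟨fun i => ⟨W (i + 1), fun a => ?_, fun a ha => ?_⟩, fun i j hij => ?_⟩
  · rw [← hψφ]
    exact (hWP _).choose _
  · rw [← hψφ]
    refine ValuationSubring.nonunits_subset_of_le (hW (Nat.le_add_left 1 i.val))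
      ((hmem _ _).mpr ?_)
    have : ((π 1).comp φ : A →+* A) = C.comp constantCoeff :=
      MvPolynomial.ringHom_ext (fun c => (((π 1).comp φ).commutes c).trans (by
        rw [RingHom.comp_apply, constantCoeff_C]; rfl)) fun l => by
        by_cases hl : l = 0 <;> simp [hφX, hπX, hl]
    exact (DFunLike.congr_fun this a).trans (by simp [RingHom.mem_ker.mp ha])
  · rw [Centered.specializes_iff, Centered.specializes_iff]
    refine ⟨hW (by simpa using hij.le), fun h => ?_⟩
    have h1 : ψ (X j) ∈ (W (j + 1)).nonunits :=
      (hmem _ _).mpr (by rw [hπX, if_pos j.val.lt_succ_self])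
    have h2 : ψ (X j) ∉ (W (i + 1)).nonunits := fun h' => by
      have := (hmem _ _).mp h'
      have hn : ¬ j.val < i.val + 1 := by have := Fin.lt_def.mp hij; omega
      rw [hπX, if_neg hn] at this
      exact X_ne_zero _ this
    exact h2 (ValuationSubring.nonunits_subset_of_le h h1)

theorem trdeg_eq_of_isAlgebraic_mvPolynomial (k : Type u) [Field k] (d : ℕ) (K : Type u) [Field K]
    [Algebra k K] [Algebra (MvPolynomial (Fin d) k) K] [IsScalarTower k (MvPolynomial (Fin d) k) K]
    [FaithfulSMul (MvPolynomial (Fin d) k) K] [Algebra.IsAlgebraic (MvPolynomial (Fin d) k) K] :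
    Algebra.trdeg k K = d := by
  rw [← trdeg_add_eq k (MvPolynomial (Fin d) k) (A := K),
    _root_.trdeg_eq_zero (R := MvPolynomial (Fin d) k) (A := K),
    MvPolynomial.trdeg_of_isDomain]
  simp

/-- The space of valuations of the field of rational functions in `d` variables centred at the
origin. -/
abbrev OriginCentered (k : Type u) [Field k] (d : ℕ) : Type u :=
  Centered (algebraMap (MvPolynomial (Fin d) k) (FractionRing (MvPolynomial (Fin d) k)))
    (RingHom.ker MvPolynomial.constantCoeff)

theorem OriginCentered.le_of_homeomorph {k : Type u} [Field k] {d e : ℕ} (he : 0 < e)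
    (h : OriginCentered k d ≃ₜ OriginCentered k e) : d ≤ e := by
  cases d with
  | zero => exact Nat.zero_le _
  | succ n =>
    have h1 := (hasSpecializationChain_centered_mvPolynomial k n).of_homeomorph h
    have h2 := Centered.natCast_le_trdeg (k := k)
      (φ := IsScalarTower.toAlgHom k (MvPolynomial (Fin e) k)
        (FractionRing (MvPolynomial (Fin e) k)))
      (I := RingHom.ker MvPolynomial.constantCoeff)
      ⟨MvPolynomial.X ⟨0, he⟩, by simp, by simp⟩ h1
    have : Algebra.IsAlgebraic (MvPolynomial (Fin e) k) (FractionRing (MvPolynomial (Fin e) k)) :=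
      IsLocalization.isAlgebraic _ (nonZeroDivisors (MvPolynomial (Fin e) k))
    rw [trdeg_eq_of_isAlgebraic_mvPolynomial k e] at h2
    exact_mod_cast h2

end SpecializationChain

section RegularPoint

open IsLocalRing

theorem ringKrullDim_quotient_add_one_le {A : Type*} [CommRing A] [IsDomain A] {P : Ideal A}
    (hP : P ≠ ⊥) : ringKrullDim (A ⧸ P) + 1 ≤ ringKrullDim A := by
  obtain ⟨f, hf, hf0⟩ := Submodule.exists_mem_ne_zero_of_ne_bot hP
  refine le_trans ?_ (ringKrullDim_quotient_succ_le_of_nonZeroDivisor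
    (mem_nonZeroDivisors_of_ne_zero hf0))
  gcongr
  exact ringKrullDim_le_of_surjective
    (Ideal.Quotient.factor ((Ideal.span_singleton_le_iff_mem P).mpr hf))
    (Ideal.Quotient.factor_surjective _)

/-- A local homomorphism whose special fibre is a field cannot raise the dimension. -/
theorem ringKrullDim_le_of_map_eq {A R : Type*} [CommRing A] [IsNoetherianRing A] [CommRing R]
    [IsLocalRing R] [IsNoetherianRing R] [Algebra A R] (m : Ideal A) [m.IsPrime]
    (h : m.map (algebraMap A R) = maximalIdeal R)
    (h' : (maximalIdeal R).comap (algebraMap A R) = m) : ringKrullDim R ≤ ringKrullDim A := by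
  have : (maximalIdeal R).LiesOver m := ⟨h'.symm⟩
  have h1 := Ideal.height_le_height_add_of_liesOver m (maximalIdeal R)
  rw [h, Ideal.map_quotient_self, Ideal.height_bot, add_zero] at h1
  rw [← maximalIdeal_height_eq_ringKrullDim]
  exact (WithBot.coe_le_coe.mpr h1).trans
    (Ideal.height_le_ringKrullDim_of_ne_top (Ideal.IsPrime.ne_top ‹_›))

theorem algebraMap_injective_of_map_eq {A R : Type*} [CommRing A] [IsDomain A]
    [IsNoetherianRing A] [CommRing R]
    [IsLocalRing R] [IsNoetherianRing R] [Algebra A R] (m : Ideal A) [m.IsPrime]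
    (h : m.map (algebraMap A R) = maximalIdeal R)
    (h' : (maximalIdeal R).comap (algebraMap A R) = m) {d : ℕ} (hA : ringKrullDim A = d)
    (hR : ringKrullDim R = d) : Function.Injective (algebraMap A R) := by
  rw [RingHom.injective_iff_ker_eq_bot]
  by_contra hP
  set P := RingHom.ker (algebraMap A R) with hPdef
  let _ : Algebra (A ⧸ P) R := (RingHom.kerLift (algebraMap A R)).toAlgebra
  have hcomp : (algebraMap (A ⧸ P) R).comp (Ideal.Quotient.mk P) = algebraMap A R :=
    RingHom.ext fun a => RingHom.kerLift_mk _ a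
  have h1 : (m.map (Ideal.Quotient.mk P)).comap (Ideal.Quotient.mk P) = m := by
    rw [Ideal.comap_map_of_surjective' _ Ideal.Quotient.mk_surjective, Ideal.mk_ker, sup_eq_left,
      ← h']
    exact fun a ha => by
      rw [Ideal.mem_comap, (RingHom.mem_ker).mp ha]
      exact zero_mem _
  have h2 : (maximalIdeal R).comap (algebraMap (A ⧸ P) R) = m.map (Ideal.Quotient.mk P) := by
    refine Ideal.comap_injective_of_surjective _ Ideal.Quotient.mk_surjective ?_
    rw [Ideal.comap_comap, hcomp, h1, h']
  have : (m.map (Ideal.Quotient.mk P)).IsPrime := h2 ▸ inferInstance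
  have h3 := ringKrullDim_le_of_map_eq (R := R) (m.map (Ideal.Quotient.mk P))
    (by rw [Ideal.map_map, hcomp, h]) h2
  have h4 := ringKrullDim_quotient_add_one_le hP
  rw [hR] at h3
  rw [hA] at h4
  have h5 : ((d : WithBot ℕ∞) + 1) ≤ d := (add_le_add_left h3 1).trans h4
  exact absurd (by exact_mod_cast h5 : d + 1 ≤ d) (by omega)

theorem exists_algebraMap_sub_mem {k B : Type*} [Field k] [IsAlgClosed k] [CommRing B]
    [Algebra k B] [Algebra.FiniteType k B] (q : Ideal B) [q.IsMaximal] (b : B) :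
    ∃ c : k, b - algebraMap k B c ∈ q := by
  let _ := Ideal.Quotient.field q
  have : Module.Finite k (B ⧸ q) := finite_of_finite_type_of_isJacobsonRing k (B ⧸ q)
  obtain ⟨c, hc⟩ := (IsAlgClosed.algebraMap_bijective_of_isIntegral (k := k) (K := B ⧸ q)).2
    (Ideal.Quotient.mk q b)
  exact ⟨c, Ideal.Quotient.eq.mp hc.symm⟩

theorem formallyUnramified_of_map_eq {A R : Type*} [CommRing A] [CommRing R] [IsLocalRing R]
    [Algebra A R] [Algebra.EssFiniteType A R] (m : Ideal A)
    (h : m.map (algebraMap A R) = maximalIdeal R)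
    (h' : ∀ r : R, ∃ a, r - algebraMap A R a ∈ maximalIdeal R) :
    Algebra.FormallyUnramified A R := by
  constructor
  have hD (x : R) (hx : x ∈ maximalIdeal R) :
      KaehlerDifferential.D A R x ∈ maximalIdeal R • (⊤ : Submodule R (Ω[R⁄A])) := by
    rw [← h] at hx
    refine Submodule.span_induction ?_ (by simp) (fun x y _ _ hx hy => ?_)
      (fun r x hx' hx => ?_) hx
    · rintro _ ⟨a, _, rfl⟩
      simp
    · rw [map_add]
      exact add_mem hx hy
    · rw [smul_eq_mul, Derivation.leibniz]
      refine add_mem (Submodule.smul_mem _ _ hx) (Submodule.smul_mem_smul ?_ trivial)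
      rw [← h]
      exact hx'
  have htop : (⊤ : Submodule R (Ω[R⁄A])) ≤ maximalIdeal R • ⊤ := by
    rw [← KaehlerDifferential.span_range_derivation, Submodule.span_le]
    rintro _ ⟨r, rfl⟩
    obtain ⟨a, ha⟩ := h' r
    have := hD _ ha
    rwa [map_sub, Derivation.map_algebraMap, sub_zero,
      ← KaehlerDifferential.span_range_derivation] at this
  have := Submodule.eq_bot_of_le_smul_of_le_jacobson_bot (maximalIdeal R) ⊤ Module.Finite.fg_top
    htop (maximalIdeal_le_jacobson _)
  exact (Submodule.subsingleton_iff R).mp (subsingleton_of_bot_eq_top this.symm)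

/-- Zariski's main theorem for a localization that is unramified over the base. -/
theorem exists_isIntegral_of_formallyUnramified {A B R : Type*} [CommRing A] [CommRing B]
    [CommRing R] [Algebra A B] [Algebra.FiniteType A B] [Algebra A R] [Algebra B R]
    [IsScalarTower A B R] (q : Ideal B) [q.IsPrime] [IsLocalization.AtPrime R q]
    [Algebra.FormallyUnramified A R] (r : R) :
    ∃ s : R, IsUnit s ∧ IsIntegral A s ∧ IsIntegral A (s * r) := by
  have : Algebra.FormallyUnramified A (Localization.AtPrime q) :=
    .of_equiv ((IsLocalization.algEquiv q.primeCompl R (Localization.AtPrime q)).restrictScalars A)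
  have : Algebra.QuasiFinite A (Localization.AtPrime q) := inferInstance
  obtain ⟨z, hzq, hz, H⟩ := Algebra.zariskisMainProperty_iff.mp
    (Algebra.ZariskisMainProperty.of_finiteType_of_weaklyQuasiFiniteAt (R := A) q)
  obtain ⟨b, t, rfl⟩ := IsLocalization.exists_mk'_eq q.primeCompl r
  obtain ⟨i, hi⟩ := H b
  obtain ⟨j, hj⟩ := H t
  have hmap {c : B} (hc : IsIntegral A c) : IsIntegral A (algebraMap B R c) :=
    hc.map (IsScalarTower.toAlgHom A B R)
  refine ⟨algebraMap B R (z ^ (i + j) * t), ?_, hmap ?_, ?_⟩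
  · exact IsLocalization.map_units R (⟨z, hzq⟩ ^ (i + j) * t : q.primeCompl)
  · rw [pow_add, mul_assoc]
    exact (hz.pow i).mul hj
  · rw [map_mul, mul_assoc, IsLocalization.mk'_spec', ← map_mul]
    refine hmap ?_
    rw [add_comm, pow_add, mul_assoc]
    exact (hz.pow j).mul hi

theorem isMaximal_ker_constantCoeff (k σ : Type*) [Field k] :
    (RingHom.ker (MvPolynomial.constantCoeff (σ := σ) (R := k))).IsMaximal :=
  RingHom.ker_isMaximal_of_surjective _ fun c =>
    ⟨MvPolynomial.C c, MvPolynomial.constantCoeff_C _ _⟩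

theorem ker_constantCoeff_eq_span_range_X (k σ : Type*) [CommRing k] :
    RingHom.ker (MvPolynomial.constantCoeff (σ := σ) (R := k)) =
      Ideal.span (Set.range MvPolynomial.X) := by
  refine le_antisymm (fun p hp => ?_) (Ideal.span_le.mpr ?_)
  · have H : p - MvPolynomial.C (MvPolynomial.constantCoeff p) ∈
        Ideal.span (Set.range (MvPolynomial.X (R := k) (σ := σ))) := by
      clear hp
      induction p using MvPolynomial.induction_on with
      | C a => simp
      | add p q hp hq =>
        rw [map_add, map_add, add_sub_add_comm]
        exact add_mem hp hq
      | mul_X p i _ =>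
        rw [map_mul, MvPolynomial.constantCoeff_X, mul_zero, map_zero, sub_zero]
        exact Ideal.mul_mem_left _ _ (Ideal.subset_span ⟨i, rfl⟩)
    rwa [(RingHom.mem_ker).mp hp, map_zero, sub_zero] at H
  · rintro _ ⟨i, rfl⟩
    exact MvPolynomial.constantCoeff_X _ i

theorem trdeg_eq_and_nonempty_homeomorph_of_map_eq {k B R K : Type u} [Field k] [IsAlgClosed k]
    [CommRing B] [Algebra k B] [Algebra.FiniteType k B] (q : Ideal B) [q.IsMaximal]
    [CommRing R] [IsLocalRing R] [Algebra B R] [IsLocalization.AtPrime R q]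
    [Field K] [Algebra R K] [IsFractionRing R K] [Algebra k K] {d : ℕ}
    [Algebra (MvPolynomial (Fin d) k) B] [IsScalarTower k (MvPolynomial (Fin d) k) B]
    [Algebra (MvPolynomial (Fin d) k) R] [IsScalarTower (MvPolynomial (Fin d) k) B R]
    [Algebra (MvPolynomial (Fin d) k) K] [IsScalarTower (MvPolynomial (Fin d) k) R K]
    [IsScalarTower k (MvPolynomial (Fin d) k) K]
    (hmap : (RingHom.ker MvPolynomial.constantCoeff).map (algebraMap (MvPolynomial (Fin d) k) R) =
      maximalIdeal R)
    (hdim : ringKrullDim R = d) :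
    Algebra.trdeg k K = d ∧ Nonempty (RZPoint (algebraMap R K) ≃ₜ OriginCentered k d) := by
  have hmax := isMaximal_ker_constantCoeff k (Fin d)
  have hcomap : (maximalIdeal R).comap (algebraMap (MvPolynomial (Fin d) k) R) =
      RingHom.ker MvPolynomial.constantCoeff :=
    (hmax.eq_of_le (Ideal.IsPrime.ne_top inferInstance) (Ideal.map_le_iff_le_comap.mp hmap.le)).symm
  have : IsNoetherianRing B := Algebra.FiniteType.isNoetherianRing k B
  have : IsNoetherianRing R := IsLocalization.isNoetherianRing q.primeCompl R inferInstance
  have : Algebra.FiniteType (MvPolynomial (Fin d) k) B := .of_restrictScalars_finiteType k _ B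
  have : Algebra.EssFiniteType B R := .of_isLocalization _ q.primeCompl
  have : Algebra.EssFiniteType (MvPolynomial (Fin d) k) R := .comp _ B R
  have hsub (r : R) : ∃ a, r - algebraMap (MvPolynomial (Fin d) k) R a ∈ maximalIdeal R := by
    obtain ⟨b, t, rfl⟩ := IsLocalization.exists_mk'_eq q.primeCompl r
    obtain ⟨c, hc⟩ := exists_algebraMap_sub_mem (k := k) q b
    obtain ⟨e, he⟩ := exists_algebraMap_sub_mem (k := k) q t
    have he0 : e ≠ 0 := fun h0 => t.2 (by simpa [h0] using he)
    refine ⟨MvPolynomial.C (c / e), ?_⟩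
    have hC (x : k) : algebraMap (MvPolynomial (Fin d) k) R (MvPolynomial.C x) =
        algebraMap B R (algebraMap k B x) := by
      rw [IsScalarTower.algebraMap_apply _ B R, ← MvPolynomial.algebraMap_eq,
        ← IsScalarTower.algebraMap_apply k (MvPolynomial (Fin d) k) B]
    have hunit := IsLocalization.map_units R t
    rw [hC, ← Ideal.unit_mul_mem_iff_mem (maximalIdeal R) hunit, mul_sub,
      IsLocalization.mk'_spec', ← map_mul, ← map_sub, ← Ideal.mem_comap, ← Ideal.under_def,
      IsLocalization.AtPrime.under_maximalIdeal R q]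
    have : b - t * algebraMap k B (c / e) =
        (b - algebraMap k B c) - (t - algebraMap k B e) * algebraMap k B (c / e) := by
      have : algebraMap k B c = algebraMap k B e * algebraMap k B (c / e) := by
        rw [← map_mul, mul_div_cancel₀ _ he0]
      rw [this]
      ring
    rw [this]
    exact sub_mem hc (q.mul_mem_right _ he)
  have := formallyUnramified_of_map_eq _ hmap hsub
  have hR : IsEtaleChart (RingHom.ker (MvPolynomial.constantCoeff (σ := Fin d) (R := k))) R :=
    ⟨hmap, hsub, exists_isIntegral_of_formallyUnramified q⟩
  have hinj : Function.Injective (algebraMap (MvPolynomial (Fin d) k) R) := by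
    refine algebraMap_injective_of_map_eq _ hmap hcomap (d := d) ?_ hdim
    rw [MvPolynomial.ringKrullDim_of_isNoetherianRing]
    simp
  have hinjK : Function.Injective (algebraMap (MvPolynomial (Fin d) k) K) := by
    rw [IsScalarTower.algebraMap_eq _ R K]
    exact (IsFractionRing.injective R K).comp hinj
  have : FaithfulSMul (MvPolynomial (Fin d) k) K :=
    (faithfulSMul_iff_algebraMap_injective _ _).mpr hinjK
  have : Algebra.FormallyUnramified R K := .of_isLocalization (nonZeroDivisors R)
  have : Algebra.FormallyUnramified (MvPolynomial (Fin d) k) K := .comp _ R K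
  have : Algebra.EssFiniteType R K := .of_isLocalization _ (nonZeroDivisors R)
  have : Algebra.EssFiniteType (MvPolynomial (Fin d) k) K := .comp _ R K
  let L := FractionRing (MvPolynomial (Fin d) k)
  let _ : Algebra L K := FractionRing.liftAlgebra (MvPolynomial (Fin d) k) K
  have : IsScalarTower (MvPolynomial (Fin d) k) L K := FractionRing.isScalarTower_liftAlgebra _ K
  have : Algebra.FormallyUnramified L K := .of_restrictScalars (MvPolynomial (Fin d) k) L K
  have : Algebra.EssFiniteType L K := .of_comp (MvPolynomial (Fin d) k) L K
  have : Algebra.IsSeparable L K := Algebra.FormallyUnramified.isSeparable L K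
  have : Module.Finite L K := Algebra.FormallyUnramified.finite_of_free L K
  have : Algebra.IsAlgebraic (MvPolynomial (Fin d) k) L :=
    IsLocalization.isAlgebraic _ (nonZeroDivisors (MvPolynomial (Fin d) k))
  have : Algebra.IsAlgebraic (MvPolynomial (Fin d) k) K := .trans _ L K
  exact ⟨trdeg_eq_of_isAlgebraic_mvPolynomial k d K, hR.nonempty_homeomorph hmax⟩

/-- The Riemann–Zariski space at a regular closed point of an affine variety is that of the origin
of affine space of the same dimension. -/
theorem IsRegularLocal.exists_homeomorph_originCentered {k B R K : Type u} [Field k]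
    [IsAlgClosed k] [CommRing B] [Algebra k B] [Algebra.FiniteType k B] (q : Ideal B) [q.IsMaximal]
    [CommRing R] [IsLocalRing R] [Algebra B R] [IsLocalization.AtPrime R q]
    [Field K] [Algebra R K] [IsFractionRing R K] [Algebra k K] [Algebra B K]
    [IsScalarTower k B K] [IsScalarTower B R K] (hR : IsRegularLocal R) :
    ∃ d : ℕ, ringKrullDim R = d ∧ Algebra.trdeg k K = d ∧
      Nonempty (RZPoint (algebraMap R K) ≃ₜ OriginCentered k d) := by
  obtain ⟨s, hs, hcard⟩ := hR
  have H (i : Fin s.card) : ∃ b : B, ∃ t : q.primeCompl,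
      (s.equivFin.symm i : R) * algebraMap B R t = algebraMap B R b := by
    obtain ⟨⟨b, t⟩, h⟩ := IsLocalization.surj q.primeCompl (s.equivFin.symm i : R)
    exact ⟨b, t, h⟩
  choose b t hbt using H
  let f : MvPolynomial (Fin s.card) k →ₐ[k] B := MvPolynomial.aeval b
  let _ : Algebra (MvPolynomial (Fin s.card) k) B := f.toAlgebra
  let _ : Algebra (MvPolynomial (Fin s.card) k) R := ((algebraMap B R).comp f.toRingHom).toAlgebra
  let _ : Algebra (MvPolynomial (Fin s.card) k) K := ((algebraMap B K).comp f.toRingHom).toAlgebra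
  have : IsScalarTower k (MvPolynomial (Fin s.card) k) B :=
    .of_algebraMap_eq fun c => (f.commutes c).symm
  have : IsScalarTower (MvPolynomial (Fin s.card) k) B R := .of_algebraMap_eq fun _ => rfl
  have : IsScalarTower (MvPolynomial (Fin s.card) k) R K :=
    .of_algebraMap_eq fun p => IsScalarTower.algebraMap_apply B R K (f p)
  have : IsScalarTower k (MvPolynomial (Fin s.card) k) K :=
    .of_algebraMap_eq fun c => by
      rw [IsScalarTower.algebraMap_apply k B K, ← f.commutes c]
      rfl
  have hX (i : Fin s.card) : algebraMap (MvPolynomial (Fin s.card) k) R (MvPolynomial.X i) =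
      s.equivFin.symm i * algebraMap B R (t i) := by
    rw [hbt, ← MvPolynomial.aeval_X (R := k) b i]
    rfl
  have hker : RingHom.ker (MvPolynomial.constantCoeff (σ := Fin s.card) (R := k)) =
      Ideal.span (Set.range MvPolynomial.X) := ker_constantCoeff_eq_span_range_X k _
  refine ⟨s.card, hcard.symm, trdeg_eq_and_nonempty_homeomorph_of_map_eq q ?_ hcard.symm⟩
  rw [hker, Ideal.map_span, ← hs]
  refine le_antisymm (Ideal.span_le.mpr ?_) (Ideal.span_le.mpr fun r hr => ?_)
  · rintro _ ⟨_, ⟨i, rfl⟩, rfl⟩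
    rw [hX]
    exact Ideal.mul_mem_right _ _ (Ideal.subset_span (s.equivFin.symm i).2)
  · refine ((Ideal.mul_unit_mem_iff_mem _
      (IsLocalization.map_units R (t (s.equivFin ⟨r, hr⟩)))).mp ?_)
    refine Ideal.subset_span ⟨_, ⟨s.equivFin ⟨r, hr⟩, rfl⟩, ?_⟩
    rw [hX, Equiv.symm_apply_apply]

end RegularPoint

section Variety

open TopologicalSpace

theorem topologicalKrullDim_le_of_isOpenEmbedding {T : Type*} [TopologicalSpace T]
    {d : WithBot ℕ∞} (H : ∀ t : T, ∃ (S : Type u) (_ : TopologicalSpace S) (f : S → T),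
      Topology.IsOpenEmbedding f ∧ t ∈ Set.range f ∧ topologicalKrullDim S ≤ d) :
    topologicalKrullDim T ≤ d := by
  rw [topologicalKrullDim, Order.krullDim_eq_iSup_coheight, iSup_le_iff]
  intro Z
  obtain ⟨z, hz⟩ := Z.isIrreducible.nonempty
  obtain ⟨S, _, f, hf, ⟨s, rfl⟩, hS⟩ := H z
  obtain ⟨W, hW⟩ := (IrreducibleCloseds.orderIsoOfIsOpenEmbedding f hf).surjective
    ⟨Z, s, hz⟩
  have hW' : IrreducibleCloseds.map f hf.continuous W = Z := congrArg Subtype.val hW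
  rw [← hW', hf.coheight_map]
  exact (Order.coheight_le_krullDim W).trans hS

theorem AlgebraicGeometry.IsAffineOpen.topologicalKrullDim_eq {X : Scheme.{u}} {U : X.Opens}
    (hU : IsAffineOpen U) : topologicalKrullDim U = ringKrullDim Γ(X, U) :=
  (IsHomeomorph.topologicalKrullDim_eq _ hU.isoSpec.hom.homeomorph.isHomeomorph).trans
    (PrimeSpectrum.topologicalKrullDim_eq_ringKrullDim Γ(X, U))

variable {k : Type u} [Field k] {X : Scheme.{u}} (s : X ⟶ Spec (CommRingCat.of k))

/-- The structure map of the sections of a scheme over `k`. -/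
def scalarsToSections (U : X.Opens) : k →+* Γ(X, U) :=
  ((Scheme.ΓSpecIso (CommRingCat.of k)).inv ≫ s.appLE ⊤ U le_top).hom

theorem finiteType_scalarsToSections [LocallyOfFiniteType s] {U : X.Opens} (hU : IsAffineOpen U) :
    (scalarsToSections s U).FiniteType := by
  rw [scalarsToSections, CommRingCat.hom_comp]
  exact (s.finiteType_appLE (isAffineOpen_top _) hU le_top).comp
    (.of_surjective _
      (Scheme.ΓSpecIso (CommRingCat.of k)).commRingCatIsoToRingEquiv.symm.surjective)

theorem map_scalarsToSections {U V : X.Opens} (h : U ≤ V) (c : k) :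
    X.presheaf.map (homOfLE h).op (scalarsToSections s V c) = scalarsToSections s U c := by
  have : s.appLE ⊤ V le_top ≫ X.presheaf.map (homOfLE h).op = s.appLE ⊤ U le_top :=
    Scheme.Hom.appLE_map _ _ _
  rw [scalarsToSections, scalarsToSections, ← this]
  rfl

variable [IsIntegral X]

/-- The structure map of the function field of an integral scheme over `k`. -/
def scalarsToFunctionField : k →+* X.functionField :=
  (X.presheaf.germ ⊤ (genericPoint X) trivial).hom.comp (scalarsToSections s ⊤)

theorem algebraMap_scalarsToSections (U : X.Opens) [Nonempty U] (c : k) :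
    algebraMap Γ(X, U) X.functionField (scalarsToSections s U c) = scalarsToFunctionField s c := by
  rw [← map_scalarsToSections s (le_top : U ≤ ⊤)]
  exact X.presheaf.germ_res_apply (homOfLE le_top) (genericPoint X) _ _

theorem topologicalKrullDim_le_of_trdeg_eq [LocallyOfFiniteType s] {d : ℕ}
    (hd : letI := (scalarsToFunctionField s).toAlgebra
      Algebra.trdeg k X.functionField = d) : topologicalKrullDim X ≤ d := by
  refine topologicalKrullDim_le_of_isOpenEmbedding fun x => ?_
  obtain ⟨_, ⟨U, hU, rfl⟩, hxU, -⟩ :=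
    X.isBasis_affineOpens.exists_subset_of_mem_open (Set.mem_univ x) isOpen_univ
  have : Nonempty U := ⟨⟨x, hxU⟩⟩
  refine ⟨U, inferInstance, _, U.isOpenEmbedding', ⟨⟨x, hxU⟩, rfl⟩, ?_⟩
  rw [IsAffineOpen.topologicalKrullDim_eq hU]
  let _ := (scalarsToFunctionField s).toAlgebra
  let _ := (scalarsToSections s U).toAlgebra
  let f : Γ(X, U) →ₐ[k] X.functionField :=
    { algebraMap Γ(X, U) X.functionField with
      commutes' := algebraMap_scalarsToSections s U }
  exact ringKrullDim_le_of_trdeg_eq f (X.germToFunctionField_injective U) hd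

/-- The Riemann–Zariski space at a regular closed point of a variety is that of the origin of
affine space of the same dimension. -/
theorem exists_RZ_homeomorph_originCentered [IsAlgClosed k] [LocallyOfFiniteType s] (x : X)
    (hx : IsClosed ({x} : Set X)) (hreg : IsRegularLocal (X.presheaf.stalk x)) :
    ∃ d : ℕ, topologicalKrullDim X = d ∧ Nonempty (RZ X x ≃ₜ OriginCentered k d) := by
  obtain ⟨_, ⟨U, hU, rfl⟩, hxU, -⟩ :=
    X.isBasis_affineOpens.exists_subset_of_mem_open (Set.mem_univ x) isOpen_univ
  let z : U := ⟨x, hxU⟩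
  have : Nonempty U := ⟨z⟩
  let _ := (scalarsToFunctionField s).toAlgebra
  let _ := (scalarsToSections s U).toAlgebra
  let _ : Algebra Γ(X, U) (X.presheaf.stalk x) := X.presheaf.algebra_section_stalk z
  have : Algebra.FiniteType k Γ(X, U) := finiteType_scalarsToSections s hU
  have : (hU.primeIdealOf z).asIdeal.IsMaximal := hU.primeIdealOf_isMaximal_of_isClosed z hx
  have : IsLocalization.AtPrime (X.presheaf.stalk x) (hU.primeIdealOf z).asIdeal :=
    hU.isLocalization_stalk z
  have : IsScalarTower k Γ(X, U) X.functionField :=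
    .of_algebraMap_eq fun c => (algebraMap_scalarsToSections s U c).symm
  have : IsScalarTower Γ(X, U) (X.presheaf.stalk x) X.functionField :=
    functionField_isScalarTower X U z
  obtain ⟨d, hd, htr, hhomeo⟩ := hreg.exists_homeomorph_originCentered (k := k)
    (K := X.functionField) (hU.primeIdealOf z).asIdeal
  refine ⟨d, le_antisymm (topologicalKrullDim_le_of_trdeg_eq s htr) ?_, hhomeo⟩
  rw [← hd, IsLocalization.AtPrime.ringKrullDim_eq_height (hU.primeIdealOf z).asIdeal]
  refine (Ideal.height_le_ringKrullDim_of_ne_top (Ideal.IsPrime.ne_top inferInstance)).trans ?_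
  rw [← hU.topologicalKrullDim_eq]
  exact topologicalKrullDim_subspace_le X U

end Variety

/-- Let `X` and `Y` be algebraic varieties over the same algebraically
closed field `k` and let `x ∈ X`, `y ∈ Y` be regular closed points.  The Riemann–Zariski
spaces `RZ(X,x)` and `RZ(Y,y)` are homeomorphic if and only if `X` and `Y` have the same
dimension. -/
theorem statement_12 {k : Type u} [Field k] [IsAlgClosed k]
    (X : Scheme.{u}) [IsIntegral X] (sπX : X ⟶ Spec (CommRingCat.of k))
    [IsSeparated sπX] [LocallyOfFiniteType sπX] [QuasiCompact sπX]
    (Y : Scheme.{u}) [IsIntegral Y] (sπY : Y ⟶ Spec (CommRingCat.of k))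
    [IsSeparated sπY] [LocallyOfFiniteType sπY] [QuasiCompact sπY]
    (hdX : 0 < topologicalKrullDim X) (hdY : 0 < topologicalKrullDim Y)
    (x : X) (hx : IsClosed ({x} : Set X)) (hxreg : IsRegularLocal (X.presheaf.stalk x))
    (y : Y) (hy : IsClosed ({y} : Set Y)) (hyreg : IsRegularLocal (Y.presheaf.stalk y)) :
    Nonempty (RZ X x ≃ₜ RZ Y y) ↔
      topologicalKrullDim X = topologicalKrullDim Y := by
  obtain ⟨d, hd, ⟨eX⟩⟩ := exists_RZ_homeomorph_originCentered sπX x hx hxreg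
  obtain ⟨e, he, ⟨eY⟩⟩ := exists_RZ_homeomorph_originCentered sπY y hy hyreg
  have hd0 : 0 < d := by
    rw [hd] at hdX
    exact_mod_cast hdX
  have he0 : 0 < e := by
    rw [he] at hdY
    exact_mod_cast hdY
  rw [hd, he]
  constructor
  · rintro ⟨h⟩
    have h' := (eX.symm.trans h).trans eY
    exact_mod_cast le_antisymm (OriginCentered.le_of_homeomorph he0 h')
      (OriginCentered.le_of_homeomorph hd0 h'.symm)
  · intro h
    obtain rfl : d = e := by exact_mod_cast h
    exact ⟨eX.trans eY.symm⟩

end
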